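/- There exists a constant c > 0 such that, as X → ∞, |Σ_{𝔞 ⊂ ℤ[i], θ_𝔞 = 0} Λ(𝔞) Φ(N(𝔞)/X)|² = (X/4)·Φ̃(1/2)² + O_Φ(X · e^{−c·√(log X)}), where the sum runs over all nonzero ideals 𝔞 of ℤ[i] with θ_𝔞 = 0. -/

import Mathlib

noncomputable section

open scoped Classical

open Complex Real Filter Asymptotics MeasureTheory

/-- The norm of an ideal of `ℤ[i]`: the cardinality of the quotient ring. -/
def idealNorm (I : Ideal GaussianInt) : ℕ := Nat.card (GaussianInt ⧸ I)

/-- The angle `θ_𝔞 ∈ [0, π/2)` attached to a nonzero ideal of `ℤ[i]`: the argument of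
the generator lying in the first quadrant. -/
def idealTheta (I : Ideal GaussianInt) : ℝ :=
  if h : ∃ α : GaussianInt, Ideal.span {α} = I ∧
      (GaussianInt.toComplex α).arg ∈ Set.Ico 0 (π / 2)
  then (GaussianInt.toComplex h.choose).arg else 0

/-- The von Mangoldt function on ideals of `ℤ[i]`: `Λ(𝔞) = log N(𝔭)` if `𝔞 = 𝔭^r` is a
power of a nonzero prime ideal `𝔭`, and `Λ(𝔞) = 0` otherwise. -/
def idealLambda (I : Ideal GaussianInt) : ℝ :=
  if h : ∃ P : Ideal GaussianInt, ∃ r : ℕ, P.IsPrime ∧ P ≠ ⊥ ∧ 0 < r ∧ I = P ^ r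
  then Real.log (idealNorm h.choose) else 0

/-- The Mellin transform `Φ̃(c) = ∫₀^∞ Φ(x) x^{c-1} dx` at a real point `c`. -/
def mellinR (Φ : ℝ → ℝ) (c : ℝ) : ℝ := ∫ x in Set.Ioi (0:ℝ), Φ x * x ^ (c - 1)

/-- The sum `∑_{𝔞, θ_𝔞 = 0} Λ(𝔞) Φ(N(𝔞)/X)` over nonzero ideals of `ℤ[i]` with `θ_𝔞 = 0`. -/
def inertSum (Φ : ℝ → ℝ) (X : ℝ) : ℝ :=
  ∑' I : {I : Ideal GaussianInt // I ≠ ⊥ ∧ idealTheta I = 0},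
    idealLambda I.1 * Φ ((idealNorm I.1 : ℝ) / X)

/-! ### Logarithmic derivatives of holomorphic functions -/

/-- Borel–Carathéodory bound for the logarithmic derivative of a zero-free function. -/
lemma norm_logDeriv_le_of_forall_ne_zero {f : ℂ → ℂ} {c z : ℂ} {r M : ℝ} (hM : 0 < M)
    (hr : 0 < r) (hf : DifferentiableOn ℂ f (Metric.ball c r))
    (hne : ∀ w ∈ Metric.ball c r, f w ≠ 0)
    (hb : ∀ w ∈ Metric.ball c r, ‖f w‖ ≤ Real.exp M * ‖f c‖) (hz : ‖z - c‖ ≤ r / 2) :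
    ‖logDeriv f z‖ ≤ 24 * M / r := by
  have hc : c ∈ Metric.ball c r := Metric.mem_ball_self hr
  have hlog : DifferentiableOn ℂ (logDeriv f) (Metric.ball c r) :=
    (hf.deriv Metric.isOpen_ball).div hf hne
  obtain ⟨g, hgc, hg⟩ := hlog.isExactOn_ball.with_val_at c 0
  have hgd : DifferentiableOn ℂ g (Metric.ball c r) :=
    fun w hw => (hg w hw).differentiableAt.differentiableWithinAt
  have hexp : ∀ w ∈ Metric.ball c r, f w = f c * Complex.exp (g w) := by
    have key : ∀ w ∈ Metric.ball c r,
        f w * Complex.exp (-g w) = f c * Complex.exp (-g c) := by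
      intro w hw
      refine Metric.isOpen_ball.is_const_of_deriv_eq_zero (𝕜 := ℂ)
        (f := fun w => f w * Complex.exp (-g w))
        (convex_ball c r).isPreconnected (hf.mul hgd.neg.cexp) ?_ hw hc
      intro u hu
      have h1 := (hf.differentiableAt (Metric.isOpen_ball.mem_nhds hu)).hasDerivAt
      have h2 := (h1.mul (hg u hu).neg.cexp).deriv
      change deriv (fun w => f w * Complex.exp (-g w)) u = 0
      erw [h2]
      have := hne u hu
      simp only [logDeriv_apply]
      field_simp
      ring
    intro w hw
    have := key w hw
    rw [hgc, neg_zero, Complex.exp_zero, mul_one, Complex.exp_neg] at this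
    rw [← this, inv_mul_cancel_right₀ (Complex.exp_ne_zero _)]
  have hre : ∀ w ∈ Metric.ball c r, (g w).re ≤ M := by
    intro w hw
    have h1 := hb w hw
    rw [hexp w hw, norm_mul, Complex.norm_exp, mul_comm] at h1
    exact Real.exp_le_exp.mp (le_of_mul_le_mul_right h1 (norm_pos_iff.mpr (hne c hc)))
  have hmem : ∀ u : ℂ, u ∈ Metric.ball (0 : ℂ) r → c + u ∈ Metric.ball c r := by
    intro u hu
    simpa [Metric.mem_ball, dist_eq_norm] using hu
  have hbd : ∀ w : ℂ, ‖w - c‖ ≤ 3 * r / 4 → ‖g w‖ ≤ 6 * M := by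
    intro w hw
    have hw0 : w - c ∈ Metric.ball (0 : ℂ) r := by
      simp only [Metric.mem_ball, dist_zero_right]; linarith
    have h := borelCaratheodory_zero (f := fun u => g (c + u)) (z := w - c) (R := r) hM
      (hgd.comp (by fun_prop) hmem) (fun u hu => hre _ (hmem u hu)) hr hw0 (by simpa using hgc)
    simp only [add_sub_cancel] at h
    refine h.trans ?_
    rw [div_le_iff₀ (by linarith)]
    nlinarith [norm_nonneg (w - c)]
  have hzb : z ∈ Metric.ball c r := by
    rw [Metric.mem_ball, dist_eq_norm]; linarith
  have hsub : Metric.closedBall z (r / 4) ⊆ Metric.ball c r := by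
    intro w hw
    rw [Metric.mem_closedBall, dist_eq_norm] at hw
    rw [Metric.mem_ball, dist_eq_norm]
    calc ‖w - c‖ = ‖(w - z) + (z - c)‖ := by ring_nf
      _ ≤ ‖w - z‖ + ‖z - c‖ := norm_add_le _ _
      _ < r := by linarith
  have hcauchy := Complex.norm_deriv_le_of_forall_mem_sphere_norm_le (c := z) (R := r / 4)
    (C := 6 * M) (f := g) (by positivity)
    ((hgd.mono hsub).diffContOnCl_ball subset_rfl) (by
      intro w hw
      apply hbd
      rw [mem_sphere_iff_norm] at hw
      calc ‖w - c‖ = ‖(w - z) + (z - c)‖ := by ring_nf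
        _ ≤ ‖w - z‖ + ‖z - c‖ := norm_add_le _ _
        _ ≤ 3 * r / 4 := by linarith)
  rw [(hg z hzb).deriv] at hcauchy
  refine hcauchy.trans (le_of_eq ?_)
  field_simp
  norm_num

/-- Dividing out a zero by a Blaschke factor. -/
lemma exists_div_blaschke {f : ℂ → ℂ} (hf : Differentiable ℂ f) {c ρ : ℂ} {R : ℝ} (hR : 0 < R)
    (hfc : f c ≠ 0) (hρ : f ρ = 0) (hρR : ‖ρ - c‖ < R) :
    ∃ g : ℂ → ℂ, Differentiable ℂ g ∧ (∀ z ∈ Metric.sphere c R, ‖g z‖ = ‖f z‖) ∧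
      (∀ z ∈ Metric.ball c R, g z = 0 → f z = 0) ∧ ‖f c‖ * R = ‖g c‖ * ‖ρ - c‖ ∧
      -(logDeriv f c).re = -(logDeriv g c).re +
        (ρ - c).re * (1 / ‖ρ - c‖ ^ 2 - 1 / R ^ 2) := by
  have hRc : (R : ℂ) ≠ 0 := by exact_mod_cast hR.ne'
  set a := ρ - c with ha
  have ha0 : a ≠ 0 := by
    intro h
    rw [ha, sub_eq_zero] at h
    exact hfc (h ▸ hρ)
  set h : ℂ → ℂ := dslope f ρ with hh
  have hhd : Differentiable ℂ h := by
    rw [← differentiableOn_univ] at hf ⊢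
    exact (Complex.differentiableOn_dslope Filter.univ_mem).mpr hf
  have hfh : ∀ z, f z = (z - ρ) * h z := by
    intro z
    have := sub_smul_dslope f ρ z
    rw [hρ, sub_zero, smul_eq_mul] at this
    exact this.symm
  set p : ℂ → ℂ := fun z => (R ^ 2 - (starRingEnd ℂ) a * (z - c)) / R with hp
  have hpd : Differentiable ℂ p := by
    intro z; simp only [hp]; fun_prop
  have hpc : p c = R := by simp [hp]; field_simp
  have hhc : h c ≠ 0 := by
    intro h0
    exact hfc (by rw [hfh, h0, mul_zero])
  have hcρ : c - ρ = -a := by simp [ha]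
  refine ⟨fun z => h z * p z, hhd.mul hpd, ?_, ?_, ?_, ?_⟩
  · intro z hz
    rw [mem_sphere_iff_norm] at hz
    rw [hfh, norm_mul, norm_mul, mul_comm]
    congr 1
    set w := z - c with hw
    have hww : (R : ℂ) ^ 2 = (starRingEnd ℂ) w * w := by
      rw [mul_comm, Complex.mul_conj, Complex.normSq_eq_norm_sq, hz]; norm_cast
    have hzρ : z - ρ = w - a := by simp [hw, ha]
    simp only [hp]
    rw [hww, ← sub_mul, ← map_sub, norm_div, norm_mul, Complex.norm_conj, hz, hzρ]
    simp [abs_of_pos hR, hR.ne']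
  · intro z hz h0
    rw [Metric.mem_ball, dist_eq_norm] at hz
    rcases mul_eq_zero.mp h0 with h1 | h1
    · rw [hfh, h1, mul_zero]
    · exfalso
      simp only [hp, div_eq_zero_iff, hRc, or_false, sub_eq_zero] at h1
      have h2 := congrArg norm h1
      rw [norm_mul, Complex.norm_conj, norm_pow, Complex.norm_real, Real.norm_eq_abs,
        abs_of_pos hR] at h2
      nlinarith [norm_nonneg a, norm_nonneg (z - c)]
  · rw [hfh c, norm_mul, norm_mul, hcρ, norm_neg, hpc, Complex.norm_real, Real.norm_eq_abs,
      abs_of_pos hR]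
    ring
  · have e1 : logDeriv f c = 1 / (c - ρ) + logDeriv h c := by
      have : f = fun z => (z - ρ) * h z := funext hfh
      rw [this, logDeriv_mul (f := fun z => z - ρ) c (by rw [hcρ]; exact neg_ne_zero.mpr ha0) hhc
        (by fun_prop) (hhd c)]
      simp [logDeriv_apply]
    have e2 : logDeriv (fun z => h z * p z) c = logDeriv h c - (starRingEnd ℂ) a / R ^ 2 := by
      rw [logDeriv_mul c hhc (by rw [hpc]; exact hRc) (hhd c) (hpd c)]
      have : deriv p c = -(starRingEnd ℂ) a / R := by
        have hd : HasDerivAt p ((0 - (starRingEnd ℂ) a * 1) / R) c :=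
          (((hasDerivAt_const c ((R : ℂ) ^ 2)).sub
            (((hasDerivAt_id c).sub_const c).const_mul _))).div_const _
        rw [hd.deriv]; ring
      rw [logDeriv_apply p, this, hpc]
      field_simp
      ring
    have e3 : logDeriv f c = logDeriv (fun z => h z * p z) c - 1 / a +
        (starRingEnd ℂ) a / R ^ 2 := by
      rw [e1, e2, hcρ, div_neg]; ring
    have e4 : (1 / a).re = a.re * (1 / ‖a‖ ^ 2) := by
      rw [one_div, Complex.inv_re, Complex.normSq_eq_norm_sq]; ring
    have e5 : ((starRingEnd ℂ) a / (R : ℂ) ^ 2).re = a.re * (1 / R ^ 2) := by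
      rw [show ((R : ℂ) ^ 2) = ((R ^ 2 : ℝ) : ℂ) by push_cast; rfl, Complex.div_ofReal_re,
        Complex.conj_re]
      ring
    rw [e3, Complex.add_re, Complex.sub_re, e4, e5]
    ring

/-- If `f` has no zeros to the right of `c`, then `-Re (f'/f)(c)` is bounded above in terms of the
growth of `f` on a disc around `c`. -/
lemma neg_re_logDeriv_le {f : ℂ → ℂ} (hf : Differentiable ℂ f) {c : ℂ} {R M : ℝ} (hR : 0 < R)
    (hM : 0 < M) (hfc : f c ≠ 0) (hz : ∀ z ∈ Metric.ball c R, f z = 0 → z.re ≤ c.re)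
    (hb : ∀ z ∈ Metric.sphere c R, ‖f z‖ ≤ Real.exp M * ‖f c‖) :
    -(logDeriv f c).re ≤ 48 * M / R := by
  have max : ∀ (f : ℂ → ℂ) (M : ℝ), Differentiable ℂ f →
      (∀ z ∈ Metric.sphere c R, ‖f z‖ ≤ Real.exp M * ‖f c‖) →
      ∀ z ∈ Metric.closedBall c R, ‖f z‖ ≤ Real.exp M * ‖f c‖ := by
    intro f M hf hb z hz
    refine Complex.norm_le_of_forall_mem_frontier_norm_le Metric.isBounded_ball
      hf.diffContOnCl (fun w hw => hb w ?_) (by rwa [closure_ball c hR.ne'])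
    rwa [frontier_ball c hR.ne'] at hw
  have main : ∀ (n : ℕ) (f : ℂ → ℂ) (M : ℝ), Differentiable ℂ f → f c ≠ 0 →
      (∀ z ∈ Metric.ball c R, f z = 0 → z.re ≤ c.re) →
      (∀ z ∈ Metric.sphere c R, ‖f z‖ ≤ Real.exp M * ‖f c‖) → 0 ≤ M → M < n * Real.log 2 →
      -(logDeriv f c).re ≤ 48 * M / R := by
    intro n
    induction n with
    | zero =>
      intro f M _ _ _ _ h0 h1
      simp only [CharP.cast_eq_zero, zero_mul] at h1
      linarith
    | succ n ih =>
      intro f M hf hfc hz hb h0 h1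
      by_cases hex : ∃ ρ ∈ Metric.ball c (R / 2), f ρ = 0
      · obtain ⟨ρ, hρ, hρ0⟩ := hex
        have hρR : ‖ρ - c‖ < R / 2 := by rwa [Metric.mem_ball, dist_eq_norm] at hρ
        obtain ⟨g, hg, hgs, hgz, hgc, hgl⟩ :=
          exists_div_blaschke hf hR hfc hρ0 (by linarith)
        have hfc0 : 0 < ‖f c‖ := norm_pos_iff.mpr hfc
        have hg2 : 2 * ‖f c‖ ≤ ‖g c‖ := by
          nlinarith [norm_nonneg (g c), norm_nonneg (ρ - c)]
        have hgc0 : g c ≠ 0 := norm_pos_iff.mp (by linarith)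
        have hgb : ∀ z ∈ Metric.sphere c R, ‖g z‖ ≤ Real.exp (M - Real.log 2) * ‖g c‖ := by
          intro z hz
          rw [hgs z hz, Real.exp_sub, Real.exp_log two_pos]
          refine (hb z hz).trans ?_
          rw [div_mul_eq_mul_div, mul_div_assoc]
          gcongr
          linarith
        have hM2 : 0 ≤ M - Real.log 2 := by
          have := max g _ hg hgb c (Metric.mem_closedBall_self hR.le)
          rw [le_mul_iff_one_le_left (norm_pos_iff.mpr hgc0)] at this
          exact Real.one_le_exp_iff.mp this
        have h := ih g (M - Real.log 2) hg hgc0 (fun z hz' h0 => hz z hz' (hgz z hz' h0)) hgb hM2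
          (by push_cast at h1; linarith)
        have hneg : (ρ - c).re * (1 / ‖ρ - c‖ ^ 2 - 1 / R ^ 2) ≤ 0 := by
          have h3 : (ρ - c).re ≤ 0 := by
            have := hz ρ (Metric.ball_subset_ball (by linarith) hρ) hρ0
            simpa using this
          have hpos : 0 < ‖ρ - c‖ := by
            rw [norm_pos_iff, sub_ne_zero]
            rintro rfl
            exact hfc hρ0
          have h4 : 1 / R ^ 2 ≤ 1 / ‖ρ - c‖ ^ 2 := by
            apply one_div_le_one_div_of_le (by positivity)
            gcongr
            linarith
          exact mul_nonpos_of_nonpos_of_nonneg h3 (by linarith)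
        rw [hgl]
        have : 48 * (M - Real.log 2) / R ≤ 48 * M / R := by
          gcongr
          have := Real.log_pos one_lt_two
          linarith
        linarith
      · push Not at hex
        have hle : ∀ ε > 0, -(logDeriv f c).re ≤ 48 * M / R + ε := by
          intro ε hε
          have hM' : 0 < M + ε * R / 48 := by positivity
          have := norm_logDeriv_le_of_forall_ne_zero (f := f) (c := c) (z := c) (r := R / 2) hM'
            (by positivity) hf.differentiableOn hex (by
              intro w hw
              refine (max f M hf hb w ?_).trans ?_
              · exact Metric.ball_subset_closedBall (Metric.ball_subset_ball (by linarith) hw)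
              · gcongr
                have : 0 ≤ ε * R / 48 := by positivity
                linarith) (by simp; positivity)
          have h5 := (neg_le_abs _).trans ((Complex.abs_re_le_norm (logDeriv f c)).trans this)
          refine h5.trans (le_of_eq ?_)
          field_simp
          ring
        exact le_of_forall_pos_le_add hle
  obtain ⟨n, hn⟩ := exists_nat_gt (M / Real.log 2)
  refine main n f M hf hfc hz hb hM.le ?_
  rwa [div_lt_iff₀ (Real.log_pos one_lt_two)] at hn

/-- Version of `neg_re_logDeriv_le` which keeps the contribution of one zero at the same height. -/
lemma neg_re_logDeriv_le_of_zero {f : ℂ → ℂ} (hf : Differentiable ℂ f) {c : ℂ} {R M d : ℝ}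
    (hR : 0 < R) (hM : 0 < M) (hfc : f c ≠ 0)
    (hz : ∀ z ∈ Metric.ball c R, f z = 0 → z.re ≤ c.re)
    (hb : ∀ z ∈ Metric.sphere c R, ‖f z‖ ≤ Real.exp M * ‖f c‖) (hd : 0 < d) (hdR : d < R)
    (h0 : f (c - d) = 0) :
    -(logDeriv f c).re ≤ 48 * M / R - 1 / d + d / R ^ 2 := by
  have hn : ‖(c - d : ℂ) - c‖ = d := by simp [abs_of_pos hd]
  obtain ⟨g, hg, hgs, hgz, hgc, hgl⟩ := exists_div_blaschke hf hR hfc h0 (by rwa [hn])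
  rw [hn] at hgc hgl
  have hfc0 : 0 < ‖f c‖ := norm_pos_iff.mpr hfc
  have hfg : ‖f c‖ ≤ ‖g c‖ := by nlinarith [norm_nonneg (g c)]
  have hgc0 : g c ≠ 0 := norm_pos_iff.mp (by linarith)
  have := neg_re_logDeriv_le hg hR hM hgc0 (fun z hz' h0 => hz z hz' (hgz z hz' h0))
    (fun z hz => by
      rw [hgs z hz]
      exact (hb z hz).trans (by gcongr))
  rw [hgl]
  have e : ((c - d : ℂ) - c).re * (1 / d ^ 2 - 1 / R ^ 2) = - 1 / d + d / R ^ 2 := by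
    simp only [sub_sub_cancel_left, neg_re, ofReal_re]
    field_simp
    ring
  rw [e]
  have : (-1 : ℝ) / d = - (1 / d) := by ring
  linarith

/-! ### Growth of Dirichlet `L`-functions -/

/-- The partial sums of a `q`-periodic sequence are linear up to a bounded error. -/
lemma exists_norm_sum_sub_mul_le (f : ℕ → ℂ) {q : ℕ} (hq : q ≠ 0) (hf : ∀ n, f (n + q) = f n) :
    ∃ (κ : ℂ) (B : ℝ), ∀ n : ℕ, ‖∑ k ∈ Finset.Icc 1 n, f k - κ * n‖ ≤ B := by
  set A : ℕ → ℂ := fun n => ∑ k ∈ Finset.Icc 1 n, f k with hA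
  have hs : ∀ n, A (n + 1) = A n + f (n + 1) := fun n => Finset.sum_Icc_succ_top (by omega) _
  have hper : ∀ n, A (n + q) = A n + A q := by
    intro n
    induction n with
    | zero => simp [hA]
    | succ n ih =>
      rw [show n + 1 + q = n + q + 1 by ring, hs, hs, ih, show n + q + 1 = n + 1 + q by ring, hf]
      ring
  set D : ℕ → ℂ := fun n => A n - A q / q * n with hD
  have hDp : Function.Periodic D q := by
    intro n
    have : (q : ℂ) ≠ 0 := by exact_mod_cast hq
    simp only [hD, hper]
    push_cast
    field_simp
    ring
  refine ⟨A q / q, ∑ k ∈ Finset.range q, ‖D k‖, fun n => ?_⟩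
  change ‖D n‖ ≤ _
  rw [← hDp.map_mod_nat]
  exact Finset.single_le_sum (f := fun k => ‖D k‖) (fun _ _ => norm_nonneg _)
    (Finset.mem_range.mpr (Nat.mod_lt _ (Nat.pos_of_ne_zero hq)))

/-- Bound and holomorphy of `s ↦ ∫₁^∞ e(u) u^{-s-1} du` for bounded `e`. -/
lemma mellin_neg_indicator_of_bounded {e : ℝ → ℂ} (he : Measurable e) {B : ℝ}
    (hB : ∀ u ∈ Set.Ioi (1 : ℝ), ‖e u‖ ≤ B) :
    (∀ s : ℂ, 0 < s.re →
      DifferentiableAt ℂ (fun s => mellin ((Set.Ioi 1).indicator e) (-s)) s) ∧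
    ∀ s : ℂ, 0 < s.re → ‖mellin ((Set.Ioi 1).indicator e) (-s)‖ ≤ B / s.re := by
  have hB0 : 0 ≤ B := (norm_nonneg _).trans (hB 2 (by norm_num))
  have hb : ∀ u, ‖(Set.Ioi (1 : ℝ)).indicator e u‖ ≤ B := by
    intro u
    by_cases hu : u ∈ Set.Ioi (1 : ℝ)
    · rw [Set.indicator_of_mem hu]; exact hB u hu
    · rw [Set.indicator_of_notMem hu, norm_zero]; exact hB0
  constructor
  · intro s hs
    refine DifferentiableAt.comp s (g := mellin ((Set.Ioi 1).indicator e)) ?_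
      differentiableAt_id.neg
    refine mellin_differentiableAt_of_isBigO_rpow (a := 0) (b := -s.re - 1) ?_ ?_ ?_ ?_ ?_
    · have : LocallyIntegrable (fun _ : ℝ => B) := locallyIntegrable_const _
      exact (this.mono (he.indicator measurableSet_Ioi).aestronglyMeasurable
        (.of_forall fun u => (hb u).trans (le_abs_self _))).locallyIntegrableOn _
    · simp only [neg_zero, Real.rpow_zero]
      exact isBigO_of_le' (c := B) _ fun u => by simpa using hb u
    · simpa using hs
    · refine IsBigO.of_bound 1 ?_
      filter_upwards [mem_nhdsWithin_of_mem_nhds (Iio_mem_nhds zero_lt_one)] with u hu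
      have hu : u < 1 := hu
      rw [Set.indicator_of_notMem (by simpa using hu.le), norm_zero]
      positivity
    · simp
  · intro s hs
    have h1 : mellin ((Set.Ioi 1).indicator e) (-s) =
        ∫ u in Set.Ioi (1 : ℝ), (u : ℂ) ^ (-s - 1) * e u := by
      rw [mellin, ← integral_indicator measurableSet_Ioi, ← integral_indicator measurableSet_Ioi]
      congr 1
      ext u
      by_cases hu : u ∈ Set.Ioi (1 : ℝ)
      · have : u ∈ Set.Ioi (0 : ℝ) := Set.Ioi_subset_Ioi zero_le_one hu
        simp [Set.indicator_of_mem hu, Set.indicator_of_mem this]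
      · simp [Set.indicator_of_notMem hu]
    rw [h1]
    have hint : IntegrableOn (fun u : ℝ => B * u ^ (-s.re - 1)) (Set.Ioi 1) :=
      (integrableOn_Ioi_rpow_of_lt (by linarith) zero_lt_one).const_mul B
    refine (norm_integral_le_of_norm_le hint ?_).trans (le_of_eq ?_)
    · refine (ae_restrict_iff' measurableSet_Ioi).mpr (.of_forall fun u hu => ?_)
      have hu0 : (0 : ℝ) < u := zero_lt_one.trans hu
      rw [norm_mul, Complex.norm_cpow_eq_rpow_re_of_pos hu0, mul_comm]
      simp only [sub_re, neg_re, one_re]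
      gcongr
      exact hB u hu
    · rw [integral_const_mul, integral_Ioi_rpow_of_lt (by linarith) zero_lt_one]
      simp only [Real.one_rpow, sub_add_cancel]
      field_simp

/-- A holomorphic function which agrees with `(s - 1) L(f, s)` for `Re s > 1`, where `f` is
periodic, has at most quadratic growth. -/
lemma exists_norm_le_of_eq_LSeries_of_periodic {f : ℕ → ℂ} {q : ℕ} (hq : q ≠ 0)
    (hf : ∀ n, f (n + q) = f n) {G : ℂ → ℂ} (hG : Differentiable ℂ G)
    (hGf : ∀ s : ℂ, 1 < s.re → G s = (s - 1) * LSeries f s) :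
    ∃ C : ℝ, 0 ≤ C ∧ ∀ s : ℂ, 1 / 2 ≤ s.re → s.re ≤ 3 → ‖G s‖ ≤ C * (|s.im| + 3) ^ 2 := by
  obtain ⟨κ, B, hB⟩ := exists_norm_sum_sub_mul_le f hq hf
  have hB0 : 0 ≤ B := (norm_nonneg _).trans (hB 0)
  set e : ℝ → ℂ := fun u => ∑ k ∈ Finset.Icc 1 ⌊u⌋₊, f k - κ * u with he
  have hem : Measurable e := by
    refine Measurable.sub ?_ (by fun_prop)
    exact (measurable_from_nat (f := fun n => ∑ k ∈ Finset.Icc 1 n, f k)).comp Nat.measurable_floor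
  have heb : ∀ u ∈ Set.Ioi (1 : ℝ), ‖e u‖ ≤ B + ‖κ‖ := by
    intro u hu
    have hu0 : (0 : ℝ) ≤ u := zero_le_one.trans (le_of_lt hu)
    have h1 : e u = (∑ k ∈ Finset.Icc 1 ⌊u⌋₊, f k - κ * (⌊u⌋₊ : ℂ)) +
        κ * (((⌊u⌋₊ : ℝ) - u : ℝ) : ℂ) := by
      simp only [he]; push_cast; ring
    rw [h1]
    refine (norm_add_le _ _).trans (add_le_add (hB _) ?_)
    rw [norm_mul, Complex.norm_real, Real.norm_eq_abs]
    refine mul_le_of_le_one_right (norm_nonneg _) ?_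
    rw [abs_le]
    constructor <;> linarith [Nat.floor_le hu0, Nat.lt_floor_add_one u]
  obtain ⟨hEd, hEb⟩ := mellin_neg_indicator_of_bounded hem heb
  set E : ℂ → ℂ := fun s => mellin ((Set.Ioi 1).indicator e) (-s) with hE
  have hsum : (fun n : ℕ => ∑ k ∈ Finset.Icc 1 n, ‖f k‖) =O[atTop] fun n => (n : ℝ) ^ (1 : ℝ) := by
    have hfb : ∀ n, ‖f n‖ ≤ ∑ k ∈ Finset.range q, ‖f k‖ := by
      intro n
      rw [← Function.Periodic.map_mod_nat (f := f) (a := q) hf]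
      exact Finset.single_le_sum (f := fun k => ‖f k‖) (fun _ _ => norm_nonneg _)
        (Finset.mem_range.mpr (Nat.mod_lt _ (Nat.pos_of_ne_zero hq)))
    refine isBigO_of_le' (c := ∑ k ∈ Finset.range q, ‖f k‖) _ fun n => ?_
    rw [Real.norm_of_nonneg (Finset.sum_nonneg fun _ _ => norm_nonneg _), Real.rpow_one,
      Real.norm_natCast]
    refine (Finset.sum_le_card_nsmul _ _ _ fun k _ => hfb k).trans (le_of_eq ?_)
    rw [Nat.card_Icc, nsmul_eq_mul, mul_comm]
    simp
  have hL : ∀ s : ℂ, 1 < s.re → G s = κ * s + s * (s - 1) * E s := by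
    intro s hs
    have hs1 : s - 1 ≠ 0 := by
      intro h
      rw [sub_eq_zero] at h
      simp [h] at hs
    have h1 : E s = ∫ u in Set.Ioi (1 : ℝ), e u * (u : ℂ) ^ (-(s + 1)) := by
      simp only [hE]
      rw [mellin, ← integral_indicator measurableSet_Ioi, ← integral_indicator measurableSet_Ioi]
      congr 1
      ext u
      by_cases hu : u ∈ Set.Ioi (1 : ℝ)
      · have h0 : u ∈ Set.Ioi (0 : ℝ) := Set.Ioi_subset_Ioi zero_le_one hu
        rw [Set.indicator_of_mem h0, Set.indicator_of_mem hu, Set.indicator_of_mem hu, smul_eq_mul,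
          mul_comm, show -(s + 1) = -s - 1 by ring]
      · simp [Set.indicator_of_notMem hu]
    have h2 : ∫ u in Set.Ioi (1 : ℝ), (u : ℂ) ^ (-s) = 1 / (s - 1) := by
      rw [integral_Ioi_cpow_of_lt (by simpa using hs) zero_lt_one]
      simp only [ofReal_one, one_cpow]
      rw [show -s + 1 = -(s - 1) by ring, neg_div_neg_eq]
    have hi2 : IntegrableOn (fun u : ℝ => (u : ℂ) ^ (-s)) (Set.Ioi 1) :=
      integrableOn_Ioi_cpow_of_lt (by simpa using hs) zero_lt_one
    have hi1 : IntegrableOn (fun u : ℝ => e u * (u : ℂ) ^ (-(s + 1))) (Set.Ioi 1) := by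
      have h3 : IntegrableOn (fun u : ℝ => (u : ℂ) ^ (-(s + 1))) (Set.Ioi 1) :=
        integrableOn_Ioi_cpow_of_lt (by simp; linarith) zero_lt_one
      exact Integrable.bdd_mul h3 hem.aestronglyMeasurable
        ((ae_restrict_iff' measurableSet_Ioi).mpr (.of_forall heb))
    rw [hGf s hs, LSeries_eq_mul_integral' f zero_le_one hs hsum]
    have h4 : ∫ t in Set.Ioi (1 : ℝ), (∑ k ∈ Finset.Icc 1 ⌊t⌋₊, f k) * (t : ℂ) ^ (-(s + 1)) =
        E s + κ * (1 / (s - 1)) := by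
      rw [h1, ← h2, ← integral_const_mul, ← integral_add hi1 (hi2.const_mul κ)]
      refine setIntegral_congr_fun measurableSet_Ioi fun u hu => ?_
      have hu0 : (u : ℂ) ≠ 0 := by
        exact_mod_cast (zero_lt_one.trans hu).ne'
      simp only [he]
      rw [show -s = 1 + -(s + 1) by ring, cpow_add _ _ hu0, cpow_one]
      ring
    rw [h4]
    field_simp
    ring
  have hext : ∀ s : ℂ, 0 < s.re → G s = κ * s + s * (s - 1) * E s := by
    have ho : IsOpen {s : ℂ | 0 < s.re} := isOpen_lt continuous_const continuous_re
    have hconv : IsPreconnected {s : ℂ | 0 < s.re} := (convex_halfSpace_re_gt 0).isPreconnected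
    have := AnalyticOnNhd.eqOn_of_preconnected_of_eventuallyEq (𝕜 := ℂ) (f := G)
      (g := fun s => κ * s + s * (s - 1) * E s) (U := {s : ℂ | 0 < s.re}) (z₀ := 2)
      (hG.differentiableOn.analyticOnNhd ho) (DifferentiableOn.analyticOnNhd (fun s hs => by
        have := hEd s hs
        exact DifferentiableAt.differentiableWithinAt (by fun_prop)) ho) hconv (by simp) (by
        filter_upwards [(isOpen_lt continuous_const continuous_re).mem_nhds
          (show (2 : ℂ) ∈ {s : ℂ | 1 < s.re} by simp)] with s hs
        exact hL s hs)
    exact fun s hs => this hs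
  refine ⟨‖κ‖ + 2 * (B + ‖κ‖), by positivity, fun s h1 h2 => ?_⟩
  have hs0 : 0 < s.re := by linarith
  have hn : ‖s‖ ≤ |s.im| + 3 := by
    have := Complex.norm_le_abs_re_add_abs_im s
    rw [abs_of_pos hs0] at this
    linarith
  have hn1 : ‖s - 1‖ ≤ |s.im| + 3 := by
    have := Complex.norm_le_abs_re_add_abs_im (s - 1)
    simp only [sub_re, one_re, sub_im, one_im, sub_zero] at this
    have h3 : |s.re - 1| ≤ 3 := by rw [abs_le]; constructor <;> linarith
    linarith
  have hE2 : ‖E s‖ ≤ 2 * (B + ‖κ‖) := by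
    refine (hEb s hs0).trans ?_
    rw [div_le_iff₀ hs0]
    nlinarith [norm_nonneg κ]
  have hT : 1 ≤ |s.im| + 3 := by linarith [abs_nonneg s.im]
  rw [hext s hs0]
  calc ‖κ * s + s * (s - 1) * E s‖ ≤ ‖κ‖ * ‖s‖ + ‖s‖ * ‖s - 1‖ * ‖E s‖ := by
        refine (norm_add_le _ _).trans ?_
        simp only [norm_mul, le_refl]
    _ ≤ ‖κ‖ * (|s.im| + 3) + (|s.im| + 3) * (|s.im| + 3) * (2 * (B + ‖κ‖)) := by gcongr
    _ ≤ (‖κ‖ + 2 * (B + ‖κ‖)) * (|s.im| + 3) ^ 2 := by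
        nlinarith [norm_nonneg κ, mul_nonneg (norm_nonneg κ) (by linarith : 0 ≤ |s.im| + 3 - 1),
          mul_nonneg (mul_nonneg (norm_nonneg κ) (by linarith : 0 ≤ |s.im| + 3))
            (by linarith : 0 ≤ |s.im| + 3 - 1)]

/-- The `L`-function of a Dirichlet character, multiplied by `s - 1` for the principal character. -/
def entireLFunction {q : ℕ} [NeZero q] (χ : DirichletCharacter ℂ q) : ℂ → ℂ :=
  if χ = 1 then DirichletCharacter.LFunctionTrivChar₁ q else χ.LFunction

lemma differentiable_entireLFunction {q : ℕ} [NeZero q] (χ : DirichletCharacter ℂ q) :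
    Differentiable ℂ (entireLFunction χ) := by
  rw [entireLFunction]
  split_ifs with h
  · exact DirichletCharacter.differentiable_LFunctionTrivChar₁ q
  · exact DirichletCharacter.differentiable_LFunction h

lemma entireLFunction_ne_zero_of_one_le_re {q : ℕ} [NeZero q] (χ : DirichletCharacter ℂ q) {s : ℂ}
    (hs : 1 ≤ s.re) : entireLFunction χ s ≠ 0 := by
  rw [entireLFunction]
  split_ifs with h
  · rcases eq_or_ne s 1 with rfl | h1
    · exact DirichletCharacter.LFunctionTrivChar₁_apply_one_ne_zero q
    · rw [DirichletCharacter.LFunctionTrivChar₁, Function.update_of_ne h1]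
      exact mul_ne_zero (sub_ne_zero.mpr h1)
        (DirichletCharacter.LFunction_ne_zero_of_one_le_re _ (.inr h1) hs)
  · exact DirichletCharacter.LFunction_ne_zero_of_one_le_re _ (.inl h) hs

lemma entireLFunction_eq_of_one_lt_re {q : ℕ} [NeZero q] (χ : DirichletCharacter ℂ q) {s : ℂ}
    (hs : 1 < s.re) :
    entireLFunction χ s = (if χ = 1 then s - 1 else 1) * LSeries (fun n => χ n) s := by
  have h1 : s ≠ 1 := by
    rintro rfl
    simp at hs
  rw [entireLFunction]
  split_ifs with h
  · rw [DirichletCharacter.LFunctionTrivChar₁, Function.update_of_ne h1, h,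
      DirichletCharacter.LFunctionTrivChar, DirichletCharacter.LFunction_eq_LSeries _ hs]
  · rw [DirichletCharacter.LFunction_eq_LSeries _ hs, one_mul]

/-- Polynomial growth of `L`-functions in a half-strip. -/
lemma exists_norm_entireLFunction_le (q : ℕ) [NeZero q] :
    ∃ A : ℝ, 0 < A ∧ ∀ (χ : DirichletCharacter ℂ q) (s : ℂ), 1 / 2 ≤ s.re → s.re ≤ 3 →
      ‖entireLFunction χ s‖ ≤ Real.exp (A * Real.log (|s.im| + 3)) := by
  have key : ∀ χ : DirichletCharacter ℂ q, ∃ C : ℝ, 0 ≤ C ∧ ∀ s : ℂ, 1 / 2 ≤ s.re → s.re ≤ 3 →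
      ‖entireLFunction χ s‖ ≤ C * (|s.im| + 3) ^ 2 := by
    intro χ
    have hper : ∀ n : ℕ, χ ((n + q : ℕ) : ZMod q) = χ (n : ZMod q) := by intro n; simp
    by_cases h : χ = 1
    · refine exists_norm_le_of_eq_LSeries_of_periodic (f := fun n => χ n)
        (NeZero.ne q) hper
        (differentiable_entireLFunction χ) fun s hs => ?_
      rw [entireLFunction_eq_of_one_lt_re χ hs, if_pos h]
    · obtain ⟨C, hC0, hC⟩ := exists_norm_le_of_eq_LSeries_of_periodic (f := fun n => χ n)
        (NeZero.ne q) hper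
        (G := fun s => (s - 1) * entireLFunction χ s)
        ((differentiable_id.sub_const _).mul (differentiable_entireLFunction χ)) fun s hs => by
          rw [entireLFunction_eq_of_one_lt_re χ hs, if_neg h, one_mul]
      obtain ⟨C', hC'⟩ := (isCompact_closedBall (1 : ℂ) 1).exists_bound_of_continuousOn
        (differentiable_entireLFunction χ).continuous.continuousOn
      refine ⟨max C C', hC0.trans (le_max_left _ _), fun s h1 h2 => ?_⟩
      have hT : 1 ≤ (|s.im| + 3) ^ 2 := one_le_pow₀ (by linarith [abs_nonneg s.im])
      by_cases hs : s ∈ Metric.closedBall (1 : ℂ) 1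
      · calc ‖entireLFunction χ s‖ ≤ C' := hC' s hs
          _ ≤ max C C' * 1 := by rw [mul_one]; exact le_max_right _ _
          _ ≤ _ := by
            have := hC0.trans (le_max_left C C')
            gcongr
      · rw [Metric.mem_closedBall, dist_eq_norm, not_le] at hs
        have := hC s h1 h2
        rw [norm_mul] at this
        calc ‖entireLFunction χ s‖ ≤ ‖s - 1‖ * ‖entireLFunction χ s‖ :=
              le_mul_of_one_le_left (norm_nonneg _) hs.le
          _ ≤ C * (|s.im| + 3) ^ 2 := this
          _ ≤ _ := by gcongr; exact le_max_left _ _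
  choose C hC0 hC using key
  obtain ⟨C₀, hC₀⟩ := (Set.finite_range C).bddAbove
  have hC₁ : ∀ χ, C χ ≤ C₀ := fun χ => hC₀ ⟨χ, rfl⟩
  have hC₀0 : 0 ≤ C₀ := (hC0 1).trans (hC₁ 1)
  refine ⟨C₀ + 2, by linarith, fun χ s h1 h2 => (hC χ s h1 h2).trans ?_⟩
  have hT : 0 < |s.im| + 3 := by linarith [abs_nonneg s.im]
  have hl : 1 ≤ Real.log (|s.im| + 3) := by
    rw [Real.le_log_iff_exp_le hT]
    linarith [Real.exp_one_lt_d9, abs_nonneg s.im]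
  have h3 : (|s.im| + 3) ^ 2 = Real.exp (2 * Real.log (|s.im| + 3)) := by
    rw [two_mul, Real.exp_add, Real.exp_log hT, sq]
  rw [add_mul, Real.exp_add, ← h3]
  gcongr
  calc C χ ≤ C₀ := hC₁ χ
    _ ≤ C₀ + 1 := by linarith
    _ ≤ Real.exp C₀ := Real.add_one_le_exp _
    _ ≤ _ := Real.exp_le_exp.mpr (le_mul_of_one_le_right hC₀0 hl)

/-- Lower bound for `L`-functions to the right of the line `Re s = 1`. -/
lemma exists_le_norm_entireLFunction (q : ℕ) [NeZero q] :
    ∃ c : ℝ, 0 < c ∧ ∀ (χ : DirichletCharacter ℂ q) (s : ℂ), 1 < s.re → s.re ≤ 3 →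
      c * (s.re - 1) ^ 2 ≤ ‖entireLFunction χ s‖ := by
  obtain ⟨C, hC⟩ := (isCompact_closedBall (1 : ℂ) 2).exists_bound_of_continuousOn
        (differentiable_entireLFunction (1 : DirichletCharacter ℂ q)).continuous.continuousOn
  have hC0 : 0 < C := by
    refine lt_of_lt_of_le (norm_pos_iff.mpr ?_) (hC 1 (by simp))
    exact entireLFunction_ne_zero_of_one_le_re _ (by simp)
  refine ⟨1 / (2 * C), by positivity, fun χ s h1 h3 => ?_⟩
  have hσ : 0 < s.re - 1 := by linarith
  have hmu := DirichletCharacter.LSeries.mul_mu_eq_one χ h1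
  set f : ℕ → ℂ := (fun n : ℕ => χ n) * fun n : ℕ => (ArithmeticFunction.moebius n : ℂ) with hf
  have hσ1 : 1 < ((s.re : ℂ)).re := by simpa using h1
  have hsum1 : LSeriesSummable (fun n : ℕ => (1 : DirichletCharacter ℂ q) n) (s.re : ℂ) :=
    DirichletCharacter.LSeriesSummable_of_one_lt_re 1 hσ1
  have hterm : ∀ n, ‖LSeries.term f s n‖ ≤
      ‖LSeries.term (fun n : ℕ => (1 : DirichletCharacter ℂ q) n) (s.re : ℂ) n‖ := by
    intro n
    rw [LSeries.norm_term_eq, LSeries.norm_term_eq]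
    split_ifs with h
    · rfl
    · simp only [ofReal_re, hf, Pi.mul_apply, norm_mul]
      gcongr
      have hm : ‖(ArithmeticFunction.moebius n : ℂ)‖ ≤ 1 := by
        rw [Complex.norm_intCast]
        exact_mod_cast ArithmeticFunction.abs_moebius_le_one
      by_cases hu : IsUnit (n : ZMod q)
      · rw [MulChar.one_apply hu, norm_one]
        exact mul_le_one₀ (DirichletCharacter.norm_le_one χ _) (norm_nonneg _) hm
      · rw [MulChar.map_nonunit _ hu, MulChar.map_nonunit _ hu, norm_zero, zero_mul]
  have hfL : ‖LSeries f s‖ ≤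
      ‖LSeries (fun n : ℕ => (1 : DirichletCharacter ℂ q) n) (s.re : ℂ)‖ := by
    have h4 : LSeries (fun n : ℕ => (1 : DirichletCharacter ℂ q) n) (s.re : ℂ) =
        ((∑' n, ‖LSeries.term (fun n : ℕ => (1 : DirichletCharacter ℂ q) n)
          (s.re : ℂ) n‖ : ℝ) : ℂ) := by
      rw [LSeries, Complex.ofReal_tsum]
      congr 1
      ext n
      rw [LSeries.norm_term_eq, LSeries.term_def]
      split_ifs with h
      · simp
      · by_cases hu : IsUnit (n : ZMod q)
        · rw [MulChar.one_apply hu]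
          simp [Complex.ofReal_cpow (Nat.cast_nonneg n)]
        · rw [MulChar.map_nonunit _ hu]; simp
    rw [h4, Complex.norm_real, Real.norm_of_nonneg (tsum_nonneg fun _ => norm_nonneg _)]
    exact tsum_of_norm_bounded hsum1.norm.hasSum hterm
  have h5 : (s.re - 1) * ‖LSeries (fun n : ℕ => (1 : DirichletCharacter ℂ q) n) (s.re : ℂ)‖ ≤
      C := by
    have h6 := hC (s.re : ℂ) (by
      rw [Metric.mem_closedBall, dist_eq_norm, ← ofReal_one, ← ofReal_sub, Complex.norm_real,
        Real.norm_of_nonneg hσ.le]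
      linarith)
    rw [entireLFunction_eq_of_one_lt_re _ hσ1, if_pos rfl, norm_mul, ← ofReal_one, ← ofReal_sub,
      Complex.norm_real, Real.norm_of_nonneg hσ.le] at h6
    exact h6
  have h7 : 1 ≤ ‖LSeries (fun n : ℕ => χ n) s‖ * ‖LSeries f s‖ := by
    rw [← norm_mul, hmu, norm_one]
  have h8 : s.re - 1 ≤ ‖LSeries (fun n : ℕ => χ n) s‖ * C := by
    calc s.re - 1 ≤ (s.re - 1) * (‖LSeries (fun n : ℕ => χ n) s‖ * ‖LSeries f s‖) :=
          le_mul_of_one_le_right hσ.le h7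
      _ ≤ ‖LSeries (fun n : ℕ => χ n) s‖ * ((s.re - 1) *
          ‖LSeries (fun n : ℕ => (1 : DirichletCharacter ℂ q) n) (s.re : ℂ)‖) := by
          rw [mul_left_comm]
          gcongr
      _ ≤ _ := by gcongr
  have h9 : (s.re - 1) / 2 ≤ ‖(if χ = 1 then s - 1 else 1 : ℂ)‖ := by
    split_ifs
    · have := Complex.re_le_norm (s - 1)
      simp only [sub_re, one_re] at this
      linarith
    · rw [norm_one]; linarith
  rw [entireLFunction_eq_of_one_lt_re χ h1, norm_mul, one_div, inv_mul_le_iff₀ (by positivity)]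
  calc (s.re - 1) ^ 2 = 2 * ((s.re - 1) / 2) * (s.re - 1) := by ring
    _ ≤ 2 * ‖(if χ = 1 then s - 1 else 1 : ℂ)‖ * (‖LSeries (fun n : ℕ => χ n) s‖ * C) := by gcongr
    _ = _ := by ring

/-! ### The zero-free region -/

lemma one_le_log_abs_add_three (t : ℝ) : 1 ≤ Real.log (|t| + 3) := by
  rw [Real.le_log_iff_exp_le (by positivity)]
  linarith [Real.exp_one_lt_d9, abs_nonneg t]

lemma log_abs_add_three_le_two_mul {t u : ℝ} (h : |u| ≤ 2 * |t| + 1 / 2) :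
    Real.log (|u| + 3) ≤ 2 * Real.log (|t| + 3) := by
  have h1 : Real.log (|t| + 3) * 2 = Real.log ((|t| + 3) ^ 2) := by
    rw [Real.log_pow]; push_cast; ring
  rw [mul_comm, h1]
  refine Real.log_le_log (by positivity) ?_
  nlinarith [abs_nonneg t]

/-- The `L`-function in a disc around `c` is controlled by its value at `c`. -/
lemma exists_norm_entireLFunction_le_exp_mul (q : ℕ) [NeZero q] :
    ∃ A : ℝ, 0 < A ∧ ∀ a : ℝ, 0 < a → ∃ K : ℝ, 0 ≤ K ∧
      ∀ (χ : DirichletCharacter ℂ q) (t : ℝ) (c z : ℂ), |c.im| ≤ 2 * |t| →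
        1 + a / Real.log (|t| + 3) ≤ c.re → c.re ≤ 5 / 2 → ‖z - c‖ ≤ 1 / 2 →
        ‖entireLFunction χ z‖ ≤
          Real.exp (A * Real.log (|t| + 3) + K) * ‖entireLFunction χ c‖ := by
  obtain ⟨A, hA0, hA⟩ := exists_norm_entireLFunction_le q
  obtain ⟨c₀, hc₀, hc⟩ := exists_le_norm_entireLFunction q
  refine ⟨2 * A + 2, by linarith, fun a ha => ⟨|Real.log (c₀ * a ^ 2)|, abs_nonneg _, ?_⟩⟩
  intro χ t c z him h1 h2 hz
  set l := Real.log (|t| + 3) with hl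
  have hl1 : 1 ≤ l := one_le_log_abs_add_three t
  have hre := (Complex.abs_re_le_norm (z - c)).trans hz
  have him2 := (Complex.abs_im_le_norm (z - c)).trans hz
  rw [sub_re, abs_le] at hre
  have him3 : |z.im| ≤ 2 * |t| + 1 / 2 := by
    calc |z.im| = |c.im + (z - c).im| := by rw [sub_im]; ring_nf
      _ ≤ |c.im| + |(z - c).im| := abs_add_le _ _
      _ ≤ _ := add_le_add him him2
  have hal : 0 < a / l := by positivity
  have hz1 := hA χ z (by linarith) (by linarith)
  have hc1 := hc χ c (by linarith) (by linarith)
  have h3 : c₀ * (a / l) ^ 2 ≤ ‖entireLFunction χ c‖ :=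
    le_trans (by gcongr; linarith) hc1
  have h4 : Real.exp (-2 * l - |Real.log (c₀ * a ^ 2)|) ≤ c₀ * (a / l) ^ 2 := by
    rw [← Real.le_log_iff_exp_le (by positivity), div_pow, ← mul_div_assoc,
      Real.log_div (by positivity) (by positivity), Real.log_pow]
    have := Real.log_le_sub_one_of_pos (by linarith : 0 < l)
    have := neg_abs_le (Real.log (c₀ * a ^ 2))
    push_cast
    linarith
  calc ‖entireLFunction χ z‖ ≤ Real.exp (A * Real.log (|z.im| + 3)) := hz1
    _ ≤ Real.exp (A * (2 * l)) := by
        gcongr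
        exact log_abs_add_three_le_two_mul him3
    _ = Real.exp ((2 * A + 2) * l + |Real.log (c₀ * a ^ 2)|) *
        Real.exp (-2 * l - |Real.log (c₀ * a ^ 2)|) := by
        rw [← Real.exp_add]; ring_nf
    _ ≤ _ := by gcongr; exact h4.trans h3

/-- The logarithmic derivative in the half-plane of absolute convergence. -/
lemma logDeriv_entireLFunction_of_one_lt_re {q : ℕ} [NeZero q] (χ : DirichletCharacter ℂ q) {s : ℂ}
    (hs : 1 < s.re) :
    -logDeriv (entireLFunction χ) s =
      LSeries ((fun n : ℕ => χ n) * fun n : ℕ => (ArithmeticFunction.vonMangoldt n : ℂ)) s -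
        if χ = 1 then 1 / (s - 1) else 0 := by
  have hs1 : s - 1 ≠ 0 := by
    intro h
    rw [sub_eq_zero] at h
    simp [h] at hs
  have hL : LSeries (fun n : ℕ => χ n) s ≠ 0 := DirichletCharacter.LSeries_ne_zero_of_one_lt_re χ hs
  have hd : DifferentiableAt ℂ (LSeries (fun n : ℕ => χ n)) s :=
    (LSeries_hasDerivAt (by
      rw [DirichletCharacter.absicssaOfAbsConv_eq_one (NeZero.ne q)]
      exact_mod_cast hs)).differentiableAt
  have hev : entireLFunction χ =ᶠ[nhds s]
      fun z => (if χ = 1 then z - 1 else 1) * LSeries (fun n : ℕ => χ n) z := by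
    filter_upwards [(isOpen_lt continuous_const continuous_re).mem_nhds hs] with z hz
    exact entireLFunction_eq_of_one_lt_re χ hz
  rw [DirichletCharacter.LSeries_twist_vonMangoldt_eq χ hs]
  have hlog : logDeriv (entireLFunction χ) s =
      logDeriv (fun z => (if χ = 1 then z - 1 else 1) * LSeries (fun n : ℕ => χ n) z) s := by
    rw [logDeriv_apply, logDeriv_apply, hev.deriv_eq, hev.eq_of_nhds]
  rw [hlog]
  split_ifs with h
  · rw [logDeriv_mul (f := fun z => z - 1) s hs1 hL (by fun_prop) hd]
    simp only [logDeriv_apply, deriv_sub_const, deriv_id'']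
    ring
  · simp only [one_mul, logDeriv_apply]
    ring

/-- The classical `3-4-1` inequality. -/
lemma re_three_four_one_nonneg {q : ℕ} [NeZero q] (χ : DirichletCharacter ℂ q) {σ : ℝ} (hσ : 1 < σ)
    (t : ℝ) :
    0 ≤ (3 * LSeries ((fun n : ℕ => (1 : DirichletCharacter ℂ q) n) *
          fun n : ℕ => (ArithmeticFunction.vonMangoldt n : ℂ)) σ +
        4 * LSeries ((fun n : ℕ => χ n) *
          fun n : ℕ => (ArithmeticFunction.vonMangoldt n : ℂ)) (σ + t * I) +
        LSeries ((fun n : ℕ => (χ ^ 2) n) *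
          fun n : ℕ => (ArithmeticFunction.vonMangoldt n : ℂ)) (σ + (2 * t : ℝ) * I)).re := by
  have h1 := DirichletCharacter.LSeriesSummable_twist_vonMangoldt (1 : DirichletCharacter ℂ q)
    (s := σ) (by simpa using hσ)
  have h2 := DirichletCharacter.LSeriesSummable_twist_vonMangoldt χ
    (s := σ + t * I) (by simpa using hσ)
  have h3 := DirichletCharacter.LSeriesSummable_twist_vonMangoldt (χ ^ 2)
    (s := σ + (2 * t : ℝ) * I) (by simpa using hσ)
  have hs := ((h1.hasSum.mul_left 3).add (h2.hasSum.mul_left 4)).add h3.hasSum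
  refine (Complex.hasSum_re hs).nonneg fun n => ?_
  simp only [LSeries.term_def, Pi.mul_apply]
  split_ifs with hn
  · simp
  by_cases hu : IsUnit (n : ZMod q)
  · have hn0 : (n : ℂ) ≠ 0 := by exact_mod_cast hn
    rw [MulChar.one_apply hu, MulChar.pow_apply' χ two_ne_zero]
    set z : ℂ := χ n * (n : ℂ) ^ (-(t * I)) with hz
    set w : ℝ := ArithmeticFunction.vonMangoldt n * (n : ℝ) ^ (-σ) with hw
    have hw0 : 0 ≤ w := mul_nonneg ArithmeticFunction.vonMangoldt_nonneg
      (Real.rpow_nonneg (Nat.cast_nonneg n) _)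
    have hz1 : ‖z‖ = 1 := by
      obtain ⟨u, hu⟩ := hu
      rw [hz, norm_mul, ← hu, DirichletCharacter.unit_norm_eq_one, one_mul,
        Complex.norm_natCast_cpow_of_pos (Nat.pos_of_ne_zero hn)]
      simp
    have hnσ : (((n : ℝ) ^ (-σ) : ℝ) : ℂ) = (n : ℂ) ^ (-(σ : ℂ)) := by
      rw [Complex.ofReal_cpow (Nat.cast_nonneg n)]; simp
    have e : 3 * (1 * (ArithmeticFunction.vonMangoldt n : ℂ) / (n : ℂ) ^ (σ : ℂ)) +
        4 * (χ n * (ArithmeticFunction.vonMangoldt n : ℂ) / (n : ℂ) ^ (σ + t * I : ℂ)) +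
        χ n ^ 2 * (ArithmeticFunction.vonMangoldt n : ℂ) / (n : ℂ) ^ (σ + (2 * t : ℝ) * I : ℂ) =
        (w : ℂ) * (3 + 4 * z + z ^ 2) := by
      rw [hw, ofReal_mul (ArithmeticFunction.vonMangoldt n), hnσ, div_eq_mul_inv, div_eq_mul_inv,
        div_eq_mul_inv, ← cpow_neg, ← cpow_neg, ← cpow_neg, neg_add, neg_add, cpow_add _ _ hn0, cpow_add _ _ hn0, hz]
      have : (n : ℂ) ^ (-((2 * t : ℝ) * I)) = (n : ℂ) ^ (-(t * I)) * (n : ℂ) ^ (-(t * I)) := by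
        rw [← cpow_add _ _ hn0]
        congr 1
        push_cast
        ring
      rw [this]
      ring
    rw [e, Complex.re_ofReal_mul]
    refine mul_nonneg hw0 ?_
    have h5 : z.re ^ 2 + z.im ^ 2 = 1 := by
      have := Complex.sq_norm z
      rw [hz1, Complex.normSq_apply] at this
      nlinarith
    have : (3 + 4 * z + z ^ 2).re = 2 * (1 + z.re) ^ 2 := by
      simp [sq]
      nlinarith
    rw [this]
    positivity
  · rw [MulChar.map_nonunit _ hu, MulChar.map_nonunit _ hu, MulChar.map_nonunit _ hu]
    simp

/-- Zeros of `L`-functions at large height stay away from the line `Re s = 1`. -/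
lemma exists_entireLFunction_ne_zero_of_large_im (q : ℕ) [NeZero q] :
    ∃ b T : ℝ, 0 < b ∧ ∀ (χ : DirichletCharacter ℂ q) (s : ℂ), T ≤ |s.im| →
      1 - b / Real.log (|s.im| + 3) ≤ s.re → entireLFunction χ s ≠ 0 := by
  obtain ⟨A, hA0, hA⟩ := exists_norm_entireLFunction_le_exp_mul q
  set a : ℝ := 1 / (1920 * (A + 1)) with ha
  have ha0 : 0 < a := by positivity
  have ha1 : a ≤ 1 / 1920 := by
    rw [ha]
    exact one_div_le_one_div_of_le (by norm_num) (by linarith)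
  have haA : 1 / a = 1920 * (A + 1) := by rw [ha, one_div_one_div]
  obtain ⟨K, hK0, hK⟩ := hA a ha0
  obtain ⟨K₁, hK₁⟩ : ∃ K₁ : ℝ, ∀ σ ∈ Set.Icc (1 : ℝ) 2,
      ‖logDeriv (entireLFunction (1 : DirichletCharacter ℂ q)) (σ : ℂ)‖ ≤ K₁ := by
    refine isCompact_Icc.exists_bound_of_continuousOn fun σ hσ => ?_
    have hd := differentiable_entireLFunction (1 : DirichletCharacter ℂ q)
    refine ContinuousAt.continuousWithinAt ?_
    refine ContinuousAt.comp (g := logDeriv (entireLFunction (1 : DirichletCharacter ℂ q))) ?_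
      Complex.continuous_ofReal.continuousAt
    exact (hd.contDiff.continuous_deriv (n := 1) le_rfl).continuousAt.div hd.continuous.continuousAt
      (entireLFunction_ne_zero_of_one_le_re _ (by simpa using hσ.1))
  refine ⟨a / 7, max 1 (Real.exp (480 * K + 3 * |K₁| + 21)), by positivity, fun χ s hT hs h0 => ?_⟩
  set t := s.im with ht
  set l := Real.log (|t| + 3) with hl
  have hl1 : 1 ≤ l := one_le_log_abs_add_three t
  have ht1 : 1 ≤ |t| := (le_max_left _ _).trans hT
  have hlT : 480 * K + 3 * |K₁| + 21 ≤ l := by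
    rw [hl, Real.le_log_iff_exp_le (by positivity)]
    linarith [(le_max_right _ _).trans hT]
  have hs1 : s.re < 1 := by
    by_contra! h
    exact entireLFunction_ne_zero_of_one_le_re χ h h0
  set σ : ℝ := 1 + a / l with hσ
  have hal : 0 < a / l := by positivity
  have hal1 : a / l ≤ 1 / 1920 := (div_le_self ha0.le hl1).trans ha1
  set d : ℝ := σ - s.re with hd
  have hd0 : 0 < d := by linarith
  have hd1 : d ≤ 8 / 7 * (a / l) := by
    have : a / 7 / l = a / l / 7 := by ring
    rw [this] at hs
    linarith
  have hd2 : d ≤ 1 / 1680 := by linarith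
  have hdinv : 7 / 8 * (1920 * (A + 1) * l) ≤ 1 / d := by
    rw [← haA, le_div_iff₀ hd0]
    calc 7 / 8 * (1 / a * l) * d ≤ 7 / 8 * (1 / a * l) * (8 / 7 * (a / l)) := by gcongr
      _ = 1 := by field_simp
  set M : ℝ := A * l + K with hM
  have hM0 : 0 < M := by positivity
  have hzero : ∀ (χ : DirichletCharacter ℂ q) (c : ℂ), c.re = σ →
      ∀ z ∈ Metric.ball c (1 / 2), entireLFunction χ z = 0 → z.re ≤ c.re := by
    intro χ c hc z _ hz
    by_contra! h
    exact entireLFunction_ne_zero_of_one_le_re χ (by linarith) hz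
  have hbound : ∀ (χ : DirichletCharacter ℂ q) (c : ℂ), c.re = σ → |c.im| ≤ 2 * |t| →
      ∀ z ∈ Metric.sphere c (1 / 2), ‖entireLFunction χ z‖ ≤
        Real.exp M * ‖entireLFunction χ c‖ := by
    intro χ c hc hc2 z hz
    exact hK χ t c z hc2 hc.ge (by linarith) (by rw [mem_sphere_iff_norm] at hz; exact hz.le)
  have hc1 : ((σ : ℂ) + t * I).re = σ := by simp
  have hc1i : ((σ : ℂ) + t * I).im = t := by simp
  have hc2 : ((σ : ℂ) + (2 * t : ℝ) * I).re = σ := by simp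
  have hc2i : ((σ : ℂ) + (2 * t : ℝ) * I).im = 2 * t := by simp
  have hσ1 : 1 < σ := by linarith
  have b1 := neg_re_logDeriv_le_of_zero (differentiable_entireLFunction χ)
    (c := σ + t * I) (d := d) one_half_pos hM0
    (entireLFunction_ne_zero_of_one_le_re χ (by rw [hc1]; exact hσ1.le))
    (hzero χ _ hc1) (hbound χ _ hc1 (by rw [hc1i]; linarith [abs_nonneg t])) hd0 (by linarith) (by
      have : (σ : ℂ) + t * I - d = s := by
        apply Complex.ext <;> simp [hd, ht]
      rw [this, h0])
  have b2 := neg_re_logDeriv_le (differentiable_entireLFunction (χ ^ 2))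
    (c := σ + (2 * t : ℝ) * I) one_half_pos hM0
    (entireLFunction_ne_zero_of_one_le_re _ (by rw [hc2]; exact hσ1.le))
    (hzero _ _ hc2) (hbound _ _ hc2 (by rw [hc2i, abs_mul]; simp))
  have b0 : -(logDeriv (entireLFunction (1 : DirichletCharacter ℂ q)) (σ : ℂ)).re ≤ |K₁| :=
    (neg_le_abs _).trans ((Complex.abs_re_le_norm _).trans
      ((hK₁ σ ⟨hσ1.le, by linarith⟩).trans (le_abs_self _)))
  have hpole : ∀ (P : Prop) [Decidable P] (u : ℝ), 1 ≤ |u| →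
      (if P then 1 / ((σ : ℂ) + u * I - 1) else 0).re ≤ 1 := by
    intro P _ u hu
    split_ifs
    · refine (Complex.re_le_norm _).trans ?_
      rw [norm_div, norm_one]
      refine div_le_one_of_le₀ ?_ (norm_nonneg _)
      refine hu.trans ?_
      have := Complex.abs_im_le_norm ((σ : ℂ) + u * I - 1)
      simpa using this
    · simp
  have main := re_three_four_one_nonneg χ hσ1 t
  have L0 := logDeriv_entireLFunction_of_one_lt_re (1 : DirichletCharacter ℂ q)
    (s := (σ : ℂ)) (by simpa using hσ1)
  have L1 := logDeriv_entireLFunction_of_one_lt_re χ (s := (σ : ℂ) + t * I) (by rwa [hc1])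
  have L2 := logDeriv_entireLFunction_of_one_lt_re (χ ^ 2) (s := (σ : ℂ) + (2 * t : ℝ) * I)
    (by rwa [hc2])
  rw [eq_sub_iff_add_eq] at L0 L1 L2
  rw [← L0, ← L1, ← L2, if_pos rfl] at main
  have e0 : (1 / ((σ : ℂ) - 1)).re = l / a := by
    rw [hσ]
    have : (((1 + a / l : ℝ) : ℂ) - 1) = ((a / l : ℝ) : ℂ) := by push_cast; ring
    rw [this, ← ofReal_one, ← ofReal_div, ofReal_re, one_div_div]
  have hla : l / a = 1920 * (A + 1) * l := by rw [← haA]; ring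
  have p1 := hpole (χ = 1) t ht1
  have p2 := hpole (χ ^ 2 = 1) (2 * t) (by rw [abs_mul]; norm_num; linarith)
  have r3 : ∀ z : ℂ, (3 * z).re = 3 * z.re := fun z => by simp
  have r4 : ∀ z : ℂ, (4 * z).re = 4 * z.re := fun z => by simp
  simp only [add_re, r3, r4, neg_re, e0, hla] at main
  have hd4 : d / (1 / 2 : ℝ) ^ 2 = 4 * d := by ring
  have hM4 : 48 * M / (1 / 2 : ℝ) = 96 * M := by ring
  rw [hd4, hM4] at b1
  rw [hM4] at b2
  nlinarith [mul_pos hA0 (by linarith : 0 < l)]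

/-- The classical zero-free region. -/
lemma exists_zero_free_region (q : ℕ) [NeZero q] :
    ∃ b : ℝ, 0 < b ∧ ∀ (χ : DirichletCharacter ℂ q) (s : ℂ),
      1 - b / Real.log (|s.im| + 3) ≤ s.re → entireLFunction χ s ≠ 0 := by
  obtain ⟨b, T, hb, hbT⟩ := exists_entireLFunction_ne_zero_of_large_im q
  set K : Set ℂ := {1} ×ℂ Set.Icc (-T) T with hK
  have hKc : IsCompact K := isCompact_singleton.reProdIm isCompact_Icc
  have hcont : Continuous fun s => ∏ χ : DirichletCharacter ℂ q, entireLFunction χ s :=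
    continuous_finsetProd _ fun χ _ => (differentiable_entireLFunction χ).continuous
  have hU : IsOpen {s | ∏ χ : DirichletCharacter ℂ q, entireLFunction χ s ≠ 0} :=
    isOpen_ne_fun hcont continuous_const
  obtain ⟨δ, hδ, hδU⟩ := hKc.exists_cthickening_subset_open hU (by
    intro s hs
    refine Finset.prod_ne_zero_iff.mpr fun χ _ => entireLFunction_ne_zero_of_one_le_re χ ?_
    exact (hs.1 : s.re = 1).ge)
  refine ⟨min b δ, lt_min hb hδ, fun χ s hs => ?_⟩
  have hl1 := one_le_log_abs_add_three s.im
  by_cases hT : T ≤ |s.im|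
  · refine hbT χ s hT (le_trans ?_ hs)
    gcongr
    exact min_le_left _ _
  · rcases le_or_gt 1 s.re with h1 | h1
    · exact entireLFunction_ne_zero_of_one_le_re χ h1
    · have hmem : s ∈ Metric.cthickening δ K := by
        refine Metric.mem_cthickening_of_dist_le s (1 + s.im * I) δ K ?_ ?_
        · refine ⟨by simp, ?_⟩
          simp only [Set.mem_preimage, add_im, one_im, mul_im, ofReal_re, I_im, mul_one, ofReal_im,
            I_re, mul_zero, add_zero, zero_add, Set.mem_Icc]
          exact abs_le.mp (not_le.mp hT).le
        · have : s - (1 + s.im * I) = ((s.re - 1 : ℝ) : ℂ) := by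
            apply Complex.ext <;> simp
          rw [dist_eq_norm, this, Complex.norm_real, Real.norm_eq_abs, abs_le]
          have h2 : min b δ / Real.log (|s.im| + 3) ≤ δ :=
            (div_le_self (lt_min hb hδ).le hl1).trans (min_le_right _ _)
          constructor <;> linarith
      exact fun h => hδU hmem (Finset.prod_eq_zero (Finset.mem_univ χ) h)

/-- Bound for the logarithmic derivative in a zero-free region. -/
lemma exists_norm_logDeriv_entireLFunction_le (q : ℕ) [NeZero q] :
    ∃ b C : ℝ, 0 < b ∧ b ≤ 1 / 4 ∧ 0 < C ∧ ∀ (χ : DirichletCharacter ℂ q) (s : ℂ),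
      1 - b / Real.log (|s.im| + 3) ≤ s.re → s.re ≤ 2 →
      entireLFunction χ s ≠ 0 ∧ ‖logDeriv (entireLFunction χ) s‖ ≤ C * (|s.im| + 3) ^ 2 := by
  obtain ⟨b', hb', hzf'⟩ := exists_zero_free_region q
  obtain ⟨b, hb, hb1, hzf⟩ : ∃ b : ℝ, 0 < b ∧ b ≤ 1 ∧ ∀ (χ : DirichletCharacter ℂ q) (s : ℂ),
      1 - b / Real.log (|s.im| + 3) ≤ s.re → entireLFunction χ s ≠ 0 := by
    refine ⟨min b' 1, lt_min hb' one_pos, min_le_right _ _, fun χ s hs => hzf' χ s (le_trans ?_ hs)⟩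
    have := one_le_log_abs_add_three s.im
    gcongr
    exact min_le_left _ _
  obtain ⟨A, hA0, hA⟩ := exists_norm_entireLFunction_le_exp_mul q
  obtain ⟨K, hK0, hK⟩ := hA (b / 8) (by positivity)
  refine ⟨b / 8, 48 * (A + K) / b, by positivity, by linarith, by positivity, fun χ s h1 h2 => ?_⟩
  set t := s.im with ht
  set l := Real.log (|t| + 3) with hl
  have hl1 : 1 ≤ l := one_le_log_abs_add_three t
  have hl0 : 0 < l := by linarith
  have e8 : b / 8 / l = b / l / 8 := by ring
  have hbl : 0 < b / l := by positivity
  have hbl1 : b / l ≤ 1 := (div_le_self hb.le hl1).trans hb1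
  rw [e8] at h1
  refine ⟨hzf χ s (by linarith), ?_⟩
  set x : ℝ := max s.re (1 + b / l / 8) with hx
  have hx1 : 1 + b / l / 8 ≤ x := le_max_right _ _
  have hx2 : x ≤ 5 / 2 := max_le (by linarith) (by linarith)
  have hsc : ‖s - (x + t * I)‖ ≤ b / l / 4 := by
    have : s - (x + t * I) = ((s.re - x : ℝ) : ℂ) := by
      apply Complex.ext <;> simp [ht]
    rw [this, Complex.norm_real, Real.norm_eq_abs, abs_le]
    have h3 : s.re ≤ x := le_max_left _ _
    have h4 : x ≤ s.re + b / l / 4 := max_le (by linarith) (by linarith)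
    constructor <;> linarith
  have hcim : ((x : ℂ) + t * I).im = t := by simp
  have hcre : ((x : ℂ) + t * I).re = x := by simp
  have hlog := norm_logDeriv_le_of_forall_ne_zero (f := entireLFunction χ) (c := x + t * I) (z := s)
    (r := b / l / 2) (M := A * l + K) (by positivity) (by positivity)
    (differentiable_entireLFunction χ).differentiableOn (by
      intro w hw
      rw [Metric.mem_ball, dist_eq_norm] at hw
      have hre := (Complex.abs_re_le_norm (w - (x + t * I))).trans hw.le
      have him := (Complex.abs_im_le_norm (w - (x + t * I))).trans hw.le
      rw [sub_re, hcre, abs_le] at hre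
      rw [sub_im, hcim] at him
      have hwim : |w.im| ≤ 2 * |t| + 1 / 2 := by
        calc |w.im| = |t + (w.im - t)| := by ring_nf
          _ ≤ |t| + |w.im - t| := abs_add_le _ _
          _ ≤ _ := by linarith [abs_nonneg t]
      have hlw := log_abs_add_three_le_two_mul hwim
      have hlw1 := one_le_log_abs_add_three w.im
      apply hzf
      have : b / l / 2 ≤ b / Real.log (|w.im| + 3) := by
        rw [div_div]
        gcongr
        linarith
      linarith)
    (fun w hw => hK χ t _ w (by rw [hcim]; linarith [abs_nonneg t]) (by rw [hcre, e8]; exact hx1)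
      (by rw [hcre]; exact hx2) (by
        rw [Metric.mem_ball, dist_eq_norm] at hw
        linarith))
    (by linarith)
  refine hlog.trans ?_
  have hlt : l ≤ |t| + 3 := by
    have := Real.log_le_sub_one_of_pos (by positivity : 0 < |t| + 3)
    linarith
  calc 24 * (A * l + K) / (b / l / 2) = 48 * (A * l + K) / b * l := by field_simp; ring
    _ ≤ 48 * (A * l + K * l) / b * l := by
        gcongr
        exact le_mul_of_one_le_right hK0 hl1
    _ = 48 * (A + K) / b * l ^ 2 := by ring
    _ ≤ _ := by gcongr

/-! ### The von Mangoldt function in residue classes -/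

open ArithmeticFunction.vonMangoldt in
/-- The regularized `L`-series of the von Mangoldt function in a residue class is holomorphic and
polynomially bounded in the zero-free region. -/
lemma exists_norm_LFunctionResidueClassAux_le {q : ℕ} [NeZero q] (a : ZMod q) :
    ∃ b C : ℝ, 0 < b ∧ b ≤ 1 / 4 ∧ 0 < C ∧ ∀ s : ℂ,
      1 - b / Real.log (|s.im| + 3) ≤ s.re → s.re ≤ 2 →
      DifferentiableAt ℂ (LFunctionResidueClassAux a) s ∧
        ‖LFunctionResidueClassAux a s‖ ≤ C * (|s.im| + 3) ^ 2 := by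
  obtain ⟨b, C, hb, hb4, hC, hbC⟩ := exists_norm_logDeriv_entireLFunction_le q
  have hdl : ∀ (χ : DirichletCharacter ℂ q) (s : ℂ), entireLFunction χ s ≠ 0 →
      DifferentiableAt ℂ (logDeriv (entireLFunction χ)) s := by
    intro χ s hs
    have hd := differentiable_entireLFunction χ
    exact ((hd.contDiff (n := 2)).differentiable_deriv_two s).div (hd s) hs
  have heq : LFunctionResidueClassAux a = fun s => (q.totient : ℂ)⁻¹ *
      (-logDeriv (entireLFunction (1 : DirichletCharacter ℂ q)) s -
        ∑ χ ∈ ({1}ᶜ : Finset (DirichletCharacter ℂ q)),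
          χ a⁻¹ * logDeriv (entireLFunction χ) s) := by
    ext s
    rw [LFunctionResidueClassAux, logDeriv_apply, neg_div, entireLFunction, if_pos rfl]
    congr 2
    refine Finset.sum_congr (by congr!) fun χ hχ => ?_
    have h1 : χ ≠ 1 := by simpa using hχ
    rw [logDeriv_apply, entireLFunction, if_neg h1, mul_div_assoc]
  refine ⟨b, ‖(q.totient : ℂ)⁻¹‖ *
    (1 + (({1}ᶜ : Finset (DirichletCharacter ℂ q)).card)) * C, hb, hb4, ?_, fun s h1 h2 => ⟨?_, ?_⟩⟩
  · have : 0 < q.totient := Nat.totient_pos.mpr (Nat.pos_of_ne_zero (NeZero.ne q))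
    have : 0 < ‖(q.totient : ℂ)⁻¹‖ := norm_pos_iff.mpr (inv_ne_zero (by exact_mod_cast this.ne'))
    positivity
  · rw [heq]
    have h := fun χ => hdl χ s (hbC χ s h1 h2).1
    refine DifferentiableAt.const_mul (.sub (h 1).neg ?_) _
    exact DifferentiableAt.fun_sum fun χ _ => (h χ).const_mul _
  · rw [heq]
    beta_reduce
    rw [norm_mul, mul_assoc, mul_assoc]
    refine mul_le_mul_of_nonneg_left ?_ (norm_nonneg _)
    refine (norm_sub_le _ _).trans ?_
    rw [add_mul, one_mul, norm_neg]
    refine add_le_add (hbC _ s h1 h2).2 ((norm_sum_le _ _).trans ?_)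
    rw [← nsmul_eq_mul]
    refine Finset.sum_le_card_nsmul _ _ _ fun χ _ => ?_
    rw [norm_mul]
    exact (mul_le_of_le_one_left (norm_nonneg _) (χ.norm_le_one _)).trans (hbC χ s h1 h2).2

/-! ### Mellin transforms of smooth functions -/

section Mellin

variable {g : ℝ → ℂ}

lemma isBigO_rpow_atTop_of_hasCompactSupport (hg : HasCompactSupport g) (a : ℝ) :
    g =O[atTop] fun u => u ^ (-a) := by
  refine IsBigO.of_bound 1 ?_
  have h : ∀ᶠ u in atTop, g u = 0 := by
    obtain ⟨R, hR⟩ := hg.isCompact.bddAbove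
    filter_upwards [eventually_gt_atTop R] with u hu
    by_contra h
    exact absurd (hR (subset_tsupport g h)) (not_le.mpr hu)
  filter_upwards [h] with u hu
  simp [hu]

lemma isBigO_rpow_nhdsGT_of_continuous (hg : Continuous g) :
    g =O[nhdsWithin 0 (Set.Ioi 0)] fun u => u ^ (-(0 : ℝ)) := by
  simp only [neg_zero, Real.rpow_zero]
  exact (hg.continuousAt.tendsto.mono_left nhdsWithin_le_nhds).isBigO_one ℝ

lemma mellinConvergent_of_hasCompactSupport (hc : Continuous g) (hg : HasCompactSupport g) {s : ℂ}
    (hs : 0 < s.re) : MellinConvergent g s :=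
  mellinConvergent_of_isBigO_rpow (hc.locallyIntegrable.locallyIntegrableOn _)
    (isBigO_rpow_atTop_of_hasCompactSupport hg _) (lt_add_one s.re)
    (isBigO_rpow_nhdsGT_of_continuous hc) hs

lemma differentiableAt_mellin_of_hasCompactSupport (hc : Continuous g) (hg : HasCompactSupport g)
    {s : ℂ} (hs : 0 < s.re) : DifferentiableAt ℂ (mellin g) s :=
  mellin_differentiableAt_of_isBigO_rpow (hc.locallyIntegrable.locallyIntegrableOn _)
    (isBigO_rpow_atTop_of_hasCompactSupport hg _) (lt_add_one s.re)
    (isBigO_rpow_nhdsGT_of_continuous hc) hs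

/-- Integration by parts for the Mellin transform. -/
lemma mul_mellin_eq_neg_mellin_mul_deriv (hc : ContDiff ℝ 1 g) (hg : HasCompactSupport g) {s : ℂ}
    (hs : 0 < s.re) : s * mellin g s = -mellin (fun u => u * deriv g u) s := by
  have hs0 : s ≠ 0 := by
    rintro rfl
    simp at hs
  have hdc : Continuous (fun u : ℝ => (u : ℂ) * deriv g u) :=
    Complex.continuous_ofReal.mul (hc.continuous_deriv le_rfl)
  have h1 := (mellinConvergent_of_hasCompactSupport hc.continuous hg hs).const_smul s
  have h2 := mellinConvergent_of_hasCompactSupport hdc (hg.deriv.mul_left) hs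
  have hder : ∀ u ∈ Set.Ioi (0 : ℝ), HasDerivAt (fun u : ℝ => (u : ℂ) ^ s * g u)
      ((u : ℂ) ^ (s - 1) • (s • g u) + (u : ℂ) ^ (s - 1) • (u * deriv g u)) u := by
    intro u hu
    have hu0 : (u : ℂ) ≠ 0 := by exact_mod_cast (ne_of_gt hu)
    have h3 := (hasDerivAt_ofReal_cpow_const' (ne_of_gt hu) (r := s - 1) (by
      intro h; apply hs0; linear_combination h)).const_mul s
    have h4 : HasDerivAt (fun u : ℝ => (u : ℂ) ^ s) (s * (u : ℂ) ^ (s - 1)) u := by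
      refine h3.congr_of_eventuallyEq (.of_forall fun v => ?_)
      simp only [sub_add_cancel]
      field_simp
    have h5 := h4.mul ((hc.differentiable one_ne_zero u).hasDerivAt)
    refine h5.congr_deriv ?_
    simp only [smul_eq_mul]
    have : (u : ℂ) ^ s = (u : ℂ) ^ (s - 1) * u := by
      rw [cpow_sub _ _ hu0, cpow_one, div_mul_cancel₀ _ hu0]
    rw [this]
    ring
  have hi := integral_Ioi_of_hasDerivAt_of_tendsto (a := 0) (m := 0)
    (f := fun u : ℝ => (u : ℂ) ^ s * g u) ?_ hder (h1.add h2) ?_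
  · rw [integral_add h1 h2] at hi
    simp only [ofReal_zero, zero_cpow hs0, zero_mul, sub_zero] at hi
    rw [← eq_neg_iff_add_eq_zero] at hi
    rw [← smul_eq_mul s, ← mellin_const_smul]
    exact hi
  · refine ContinuousAt.continuousWithinAt ?_
    refine ContinuousAt.mul ?_ hc.continuous.continuousAt
    exact Complex.continuousAt_ofReal_cpow_const 0 s (Or.inl hs)
  · refine tendsto_const_nhds.congr' ?_
    obtain ⟨R, hR⟩ := hg.isCompact.bddAbove
    filter_upwards [eventually_gt_atTop R] with u hu
    have : g u = 0 := by
      by_contra h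
      exact absurd (hR (subset_tsupport g h)) (not_le.mpr hu)
    rw [this, mul_zero]

lemma exists_norm_mellin_le (hc : Continuous g) (hg : HasCompactSupport g) :
    ∃ C : ℝ, 0 ≤ C ∧ ∀ s : ℂ, 1 / 2 ≤ s.re → s.re ≤ 2 → ‖mellin g s‖ ≤ C := by
  have h1 := (mellinConvergent_of_hasCompactSupport hc hg (s := ((1 / 2 : ℝ) : ℂ))
    (by rw [ofReal_re]; norm_num)).norm
  have h2 := (mellinConvergent_of_hasCompactSupport hc hg (s := ((2 : ℝ) : ℂ))
    (by rw [ofReal_re]; norm_num)).norm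
  refine ⟨_, ?_, fun s hs1 hs2 => norm_integral_le_of_norm_le (h1.add h2) ?_⟩
  · exact integral_nonneg fun u => add_nonneg (norm_nonneg _) (norm_nonneg _)
  · refine (ae_restrict_iff' measurableSet_Ioi).mpr (.of_forall fun u hu => ?_)
    have hu : 0 < u := hu
    simp only [norm_smul, Pi.add_apply, Complex.norm_cpow_eq_rpow_re_of_pos hu, sub_re, one_re,
      ofReal_re]
    rw [← add_mul]
    refine mul_le_mul_of_nonneg_right ?_ (norm_nonneg _)
    rcases le_total 1 u with h | h
    · refine le_add_of_nonneg_of_le (by positivity) ?_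
      exact Real.rpow_le_rpow_of_exponent_le h (by linarith)
    · refine le_add_of_le_of_nonneg ?_ (by positivity)
      exact Real.rpow_le_rpow_of_exponent_ge hu h (by linarith)

/-- Mellin transforms of smooth compactly supported functions decay rapidly on vertical lines. -/
lemma exists_norm_mellin_mul_pow_le (k : ℕ) : ∀ {g : ℝ → ℂ}, ContDiff ℝ (⊤ : ℕ∞) g →
    HasCompactSupport g → ∃ C : ℝ, 0 ≤ C ∧ ∀ s : ℂ, 1 / 2 ≤ s.re → s.re ≤ 2 →
      ‖mellin g s‖ * (|s.im| + 3) ^ k ≤ C := by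
  induction k with
  | zero =>
    intro g hc hg
    simpa using exists_norm_mellin_le hc.continuous hg
  | succ k ih =>
    intro g hc hg
    have hd : ContDiff ℝ (⊤ : ℕ∞) (fun u : ℝ => (u : ℂ) * deriv g u) :=
      Complex.ofRealCLM.contDiff.mul (contDiff_infty_iff_deriv.mp hc).2
    obtain ⟨C, hC0, hC⟩ := ih hd hg.deriv.mul_left
    refine ⟨7 * C, by positivity, fun s h1 h2 => ?_⟩
    have hs : 0 < s.re := by linarith
    have h3 := congrArg norm (mul_mellin_eq_neg_mellin_mul_deriv (hc.of_le (mod_cast le_top)) hg hs)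
    rw [norm_neg, norm_mul] at h3
    have h4 : |s.im| + 3 ≤ 7 * ‖s‖ := by
      have := Complex.abs_im_le_norm s
      have := Complex.re_le_norm s
      linarith
    calc ‖mellin g s‖ * (|s.im| + 3) ^ (k + 1)
        = (|s.im| + 3) * ‖mellin g s‖ * (|s.im| + 3) ^ k := by ring
      _ ≤ 7 * ‖s‖ * ‖mellin g s‖ * (|s.im| + 3) ^ k := by gcongr
      _ = 7 * ((‖s‖ * ‖mellin g s‖) * (|s.im| + 3) ^ k) := by ring
      _ ≤ 7 * C := by rw [h3]; gcongr; exact hC s h1 h2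

end Mellin

/-! ### Mellin inversion and sums over arithmetic functions -/

section MellinInversion

variable {g : ℝ → ℂ}

lemma verticalIntegrable_mellin (hc : ContDiff ℝ (⊤ : ℕ∞) g) (hg : HasCompactSupport g) {σ : ℝ}
    (h1 : 1 / 2 ≤ σ) (h2 : σ ≤ 2) : VerticalIntegrable (mellin g) σ := by
  obtain ⟨C, hC0, hC⟩ := exists_norm_mellin_mul_pow_le 2 hc hg
  refine (integrable_inv_one_add_sq.const_mul C).mono' ?_ (.of_forall fun y => ?_)
  · refine Continuous.aestronglyMeasurable (continuous_iff_continuousAt.mpr fun y => ?_)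
    refine ContinuousAt.comp (g := mellin g) (f := fun y : ℝ => (σ + y * I : ℂ)) ?_
      (by fun_prop : Continuous fun y : ℝ => (σ + y * I : ℂ)).continuousAt
    refine (differentiableAt_mellin_of_hasCompactSupport hc.continuous hg ?_).continuousAt
    simp; linarith
  · have h := hC (σ + y * I) (by simpa using h1) (by simpa using h2)
    simp only [add_im, ofReal_im, mul_im, ofReal_re, I_im, mul_one, I_re, mul_zero, add_zero,
      zero_add] at h
    rw [← div_eq_mul_inv, le_div_iff₀ (by positivity)]
    refine le_trans ?_ h
    gcongr
    have := abs_nonneg y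
    nlinarith [sq_abs y]

lemma eq_integral_mellin (hc : ContDiff ℝ (⊤ : ℕ∞) g) (hg : HasCompactSupport g) {σ u : ℝ}
    (h1 : 1 / 2 ≤ σ) (h2 : σ ≤ 2) (hu : 0 < u) :
    g u = (1 / (2 * π) : ℝ) * ∫ y : ℝ, (u : ℂ) ^ (-(σ + y * I : ℂ)) * mellin g (σ + y * I) := by
  have h := mellinInv_mellin_eq σ g hu
    (mellinConvergent_of_hasCompactSupport hc.continuous hg (s := σ) (by simp; linarith))
    (verticalIntegrable_mellin hc hg h1 h2) hc.continuous.continuousAt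
  rw [← h, mellinInv]
  simp

/-- The Mellin inversion formula applied termwise to a Dirichlet series. -/
lemma tsum_mul_eq_integral_mellin_mul_LSeries (hc : ContDiff ℝ (⊤ : ℕ∞) g)
    (hg : HasCompactSupport g) {σ x : ℝ} (h1 : 1 / 2 ≤ σ) (h2 : σ ≤ 2) (hx : 0 < x) {f : ℕ → ℂ}
    (hf0 : f 0 = 0) (hf : LSeriesSummable f σ) :
    ∑' n, f n * g (n / x) = (1 / (2 * π) : ℝ) *
      ∫ y : ℝ, mellin g (σ + y * I) * (x : ℂ) ^ (σ + y * I : ℂ) * LSeries f (σ + y * I) := by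
  have hxc : (x : ℂ) ≠ 0 := by exact_mod_cast hx.ne'
  set F : ℕ → ℝ → ℂ := fun n y =>
    mellin g (σ + y * I) * (x : ℂ) ^ (σ + y * I : ℂ) * LSeries.term f (σ + y * I) n with hF
  have hM := verticalIntegrable_mellin hc hg h1 h2
  have hnorm : ∀ n y, ‖F n y‖ = ‖mellin g (σ + y * I)‖ * (x ^ σ * ‖LSeries.term f σ n‖) := by
    intro n y
    simp only [hF, norm_mul]
    rw [Complex.norm_cpow_eq_rpow_re_of_pos hx, mul_assoc]
    simp [LSeries.norm_term_eq]
  have hFi : ∀ n, Integrable (F n) := by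
    intro n
    refine (hM.norm.mul_const (x ^ σ * ‖LSeries.term f σ n‖)).mono' ?_
      (.of_forall fun y => (hnorm n y).le)
    refine AEStronglyMeasurable.mul (hM.aestronglyMeasurable.mul ?_) ?_
    · refine Continuous.aestronglyMeasurable ?_
      exact (by fun_prop : Continuous fun y : ℝ => (σ + y * I : ℂ)).const_cpow (Or.inl hxc)
    · refine Continuous.aestronglyMeasurable ?_
      rcases eq_or_ne n 0 with rfl | hn
      · simpa using continuous_const
      · simp only [LSeries.term_of_ne_zero hn]
        refine continuous_const.div ?_ fun y => ?_
        · exact (by fun_prop : Continuous fun y : ℝ => (σ + y * I : ℂ)).const_cpow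
            (Or.inl (by exact_mod_cast hn))
        · rw [Ne, cpow_eq_zero_iff]
          exact fun h => hn (by exact_mod_cast h.1)
  have hs : Summable fun n => ∫ y, ‖F n y‖ := by
    simp_rw [hnorm, integral_mul_const]
    exact (hf.norm.mul_left _).mul_left _
  have h := (hasSum_integral_of_summable_integral_norm hFi hs).tsum_eq
  have h3 : (∫ y, ∑' n, F n y) = ∫ y : ℝ, mellin g (σ + y * I) * (x : ℂ) ^ (σ + y * I : ℂ) *
      LSeries f (σ + y * I) := by
    simp_rw [hF, tsum_mul_left]
    rfl
  rw [← h3, ← h, ← tsum_mul_left]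
  refine tsum_congr fun n => ?_
  rcases eq_or_ne n 0 with rfl | hn
  · simp [hf0, hF]
  have hn' : (0 : ℝ) < n := by exact_mod_cast Nat.pos_of_ne_zero hn
  rw [eq_integral_mellin hc hg h1 h2 (div_pos hn' hx), mul_left_comm, ← integral_const_mul]
  congr 2
  ext y
  simp only [hF, LSeries.term_of_ne_zero hn]
  rw [ofReal_div, Complex.div_cpow_ofReal_nonneg hn'.le hx.le, cpow_neg, cpow_neg, ofReal_natCast]
  field_simp

lemma integral_Ioi_one_eq_integral_mellin (hc : ContDiff ℝ (⊤ : ℕ∞) g)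
    (hg : HasCompactSupport g) {σ x : ℝ} (h1 : 1 < σ) (h2 : σ ≤ 2) (hx : 0 < x) :
    ∫ u in Set.Ioi (1 : ℝ), g (u / x) = (1 / (2 * π) : ℝ) *
      ∫ y : ℝ, mellin g (σ + y * I) * (x : ℂ) ^ (σ + y * I : ℂ) * (1 / (σ + y * I - 1)) := by
  have hxc : (x : ℂ) ≠ 0 := by exact_mod_cast hx.ne'
  have hM := verticalIntegrable_mellin hc hg (by linarith) h2
  have hxy : ∀ y : ℝ, ‖mellin g (σ + y * I) * (x : ℂ) ^ (σ + y * I : ℂ)‖ =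
      ‖mellin g (σ + y * I)‖ * x ^ σ := by
    intro y
    rw [norm_mul, Complex.norm_cpow_eq_rpow_re_of_pos hx]
    simp
  have hMx : Integrable fun y : ℝ => mellin g (σ + y * I) * (x : ℂ) ^ (σ + y * I : ℂ) := by
    refine (hM.norm.mul_const (x ^ σ)).mono' ?_ (.of_forall fun y => (hxy y).le)
    refine hM.aestronglyMeasurable.mul (Continuous.aestronglyMeasurable ?_)
    exact (by fun_prop : Continuous fun y : ℝ => (σ + y * I : ℂ)).const_cpow (Or.inl hxc)
  have hu : Integrable (fun u : ℝ => u ^ (-σ)) (volume.restrict (Set.Ioi 1)) :=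
    integrableOn_Ioi_rpow_of_lt (by linarith) one_pos
  have hprod : Integrable (Function.uncurry fun (u y : ℝ) =>
      mellin g (σ + y * I) * (x : ℂ) ^ (σ + y * I : ℂ) * (u : ℂ) ^ (-(σ + y * I : ℂ)))
      ((volume.restrict (Set.Ioi 1)).prod volume) := by
    refine (hu.mul_prod hMx.norm).mono' ?_ ?_
    · refine AEStronglyMeasurable.mul (hMx.aestronglyMeasurable.comp_snd) ?_
      exact Measurable.aestronglyMeasurable (by fun_prop)
    · have : ∀ᵐ p : ℝ × ℝ ∂((volume.restrict (Set.Ioi 1)).prod volume), p.1 ∈ Set.Ioi (1 : ℝ) :=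
        Measure.quasiMeasurePreserving_fst.ae (ae_restrict_mem measurableSet_Ioi)
      filter_upwards [this] with p hp
      have hp : 0 < p.1 := zero_lt_one.trans hp
      simp only [Function.uncurry]
      rw [norm_mul _ ((p.1 : ℂ) ^ _), Complex.norm_cpow_eq_rpow_re_of_pos hp, mul_comm]
      simp
  have hswap := integral_integral_swap hprod
  have hr : ∀ y : ℝ, ∫ u in Set.Ioi (1 : ℝ), mellin g (σ + y * I) * (x : ℂ) ^ (σ + y * I : ℂ) *
      (u : ℂ) ^ (-(σ + y * I : ℂ)) =
      mellin g (σ + y * I) * (x : ℂ) ^ (σ + y * I : ℂ) * (1 / (σ + y * I - 1)) := by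
    intro y
    rw [integral_const_mul, integral_Ioi_cpow_of_lt (by simp; linarith) one_pos, ofReal_one,
      one_cpow, ← neg_div_neg_eq, neg_neg]
    congr 2
    ring
  simp_rw [hr] at hswap
  rw [← hswap, ← integral_const_mul]
  refine setIntegral_congr_fun measurableSet_Ioi fun u hu => ?_
  have hu : 0 < u := zero_lt_one.trans hu
  rw [eq_integral_mellin hc hg (by linarith) h2 (div_pos hu hx)]
  congr 2
  ext y
  rw [ofReal_div, Complex.div_cpow_ofReal_nonneg hu.le hx.le, cpow_neg _ _, cpow_neg (x : ℂ)]
  field_simp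

end MellinInversion

/-! ### Shifting a vertical contour -/

lemma norm_integral_vertical_le {K : ℂ → ℂ} {σ₁ σ₀ T A A₁ : ℝ} (hσ : σ₁ ≤ σ₀)
    (hσ' : σ₀ - σ₁ ≤ 2) (hT : 0 < T) (hA : 0 ≤ A) (hA₁ : 0 ≤ A₁)
    (hd : ∀ s : ℂ, σ₁ ≤ s.re → s.re ≤ σ₀ → |s.im| ≤ T → DifferentiableAt ℂ K s)
    (hi : Integrable fun y : ℝ => K (σ₀ + y * I))
    (h0 : ∀ y : ℝ, T ≤ |y| → ‖K (σ₀ + y * I)‖ ≤ A / T * (1 + y ^ 2)⁻¹)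
    (hh : ∀ s : ℂ, σ₁ ≤ s.re → s.re ≤ σ₀ → |s.im| = T → ‖K s‖ ≤ A / T)
    (h1 : ∀ y : ℝ, |y| ≤ T → ‖K (σ₁ + y * I)‖ ≤ A₁ * (1 + y ^ 2)⁻¹) :
    ‖∫ y : ℝ, K (σ₀ + y * I)‖ ≤ (π + 4) * (A / T) + π * A₁ := by
  have hAT : 0 ≤ A / T := by positivity
  have hrect := Complex.integral_boundary_rect_eq_zero_of_differentiableOn K (σ₁ + (-T : ℝ) * I)
    (σ₀ + T * I) (fun s hs => (hd s ?_ ?_ ?_).differentiableWithinAt)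
  rotate_left
  · have := hs.1; simp [Set.uIcc_of_le hσ] at this; exact this.1
  · have := hs.1; simp [Set.uIcc_of_le hσ] at this; exact this.2
  · have := hs.2; simp [Set.uIcc_of_le (neg_le_self hT.le)] at this; exact abs_le.mpr this
  simp only [add_re, ofReal_re, mul_re, I_re, mul_zero, ofReal_im, I_im, mul_one, sub_self,
    add_zero, add_im, mul_im, zero_add] at hrect
  have hhor : ∀ τ : ℝ, |τ| = T → ‖∫ t in σ₁..σ₀, K (t + τ * I)‖ ≤ 2 * (A / T) := by
    intro τ hτ
    refine (intervalIntegral.norm_integral_le_of_norm_le_const (C := A / T)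
      fun t ht => ?_).trans ?_
    · rw [Set.uIoc_of_le hσ] at ht
      exact hh _ (by simpa using ht.1.le) (by simpa using ht.2) (by simpa using hτ)
    · rw [abs_of_nonneg (by linarith), mul_comm]
      gcongr
  have hleft : ‖∫ y in (-T)..T, K (σ₁ + y * I)‖ ≤ π * A₁ := by
    rw [intervalIntegral.integral_of_le (neg_le_self hT.le)]
    refine (norm_integral_le_of_norm_le ((integrable_inv_one_add_sq.const_mul A₁).integrableOn)
      ((ae_restrict_iff' measurableSet_Ioc).mpr (.of_forall fun y hy =>
        h1 y (abs_le.mpr ⟨hy.1.le, hy.2⟩)))).trans ?_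
    refine (setIntegral_le_integral (integrable_inv_one_add_sq.const_mul A₁)
      (.of_forall fun y => by simp only [Pi.zero_apply]; positivity)).trans ?_
    rw [integral_const_mul, integral_univ_inv_one_add_sq, mul_comm]
  have htail : ‖∫ y in (Set.Ioc (-T) T)ᶜ, K (σ₀ + y * I)‖ ≤ π * (A / T) := by
    refine (norm_integral_le_of_norm_le
      ((integrable_inv_one_add_sq.const_mul (A / T)).integrableOn)
      ((ae_restrict_iff' measurableSet_Ioc.compl).mpr (.of_forall fun y hy =>
        h0 y ?_))).trans ?_
    · by_contra h
      have := abs_lt.mp (not_le.mp h)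
      exact hy ⟨this.1, this.2.le⟩
    refine (setIntegral_le_integral (integrable_inv_one_add_sq.const_mul (A / T))
      (.of_forall fun y => by simp only [Pi.zero_apply]; positivity)).trans ?_
    rw [integral_const_mul, integral_univ_inv_one_add_sq, mul_comm]
  have hsplit := integral_add_compl measurableSet_Ioc (s := Set.Ioc (-T) T) hi
  rw [← intervalIntegral.integral_of_le (neg_le_self hT.le)] at hsplit
  have hb := hhor (-T) (by rw [abs_neg, abs_of_pos hT])
  have ht := hhor T (abs_of_pos hT)
  have hmid : ‖∫ y in (-T)..T, K (σ₀ + y * I)‖ ≤ 4 * (A / T) + π * A₁ := by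
    have : ‖I • ∫ y in (-T)..T, K (σ₀ + y * I)‖ ≤ 4 * (A / T) + π * A₁ := by
      have e : I • (∫ y in (-T)..T, K (σ₀ + y * I)) =
          (∫ t in σ₁..σ₀, K (t + T * I)) - (∫ t in σ₁..σ₀, K (t + (-T : ℝ) * I)) +
          I • ∫ y in (-T)..T, K (σ₁ + y * I) := by
        linear_combination hrect
      rw [e]
      refine (norm_add_le _ _).trans (add_le_add ((norm_sub_le _ _).trans ?_) ?_)
      · linarith
      · rw [norm_smul, norm_I, one_mul]; exact hleft
    rwa [norm_smul, norm_I, one_mul] at this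
  rw [← hsplit]
  refine (norm_add_le _ _).trans ?_
  linarith

/-! ### Smooth sums of the von Mangoldt function in residue classes -/

section ResidueClass

open ArithmeticFunction.vonMangoldt

variable {g : ℝ → ℂ} {q : ℕ} [NeZero q] {a : ZMod q}

lemma tsum_residueClass_sub_eq_integral (ha : IsUnit a) (hc : ContDiff ℝ (⊤ : ℕ∞) g)
    (hg : HasCompactSupport g) {σ x : ℝ} (h1 : 1 < σ) (h2 : σ ≤ 2) (hx : 0 < x)
    (hi : Integrable fun y : ℝ => mellin g (σ + y * I) * (x : ℂ) ^ (σ + y * I : ℂ) *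
      LFunctionResidueClassAux a (σ + y * I)) :
    ∑' n, (residueClass a n : ℂ) * g (n / x) -
      (q.totient : ℂ)⁻¹ * ∫ u in Set.Ioi (1 : ℝ), g (u / x) =
    (1 / (2 * π) : ℝ) * ∫ y : ℝ, mellin g (σ + y * I) * (x : ℂ) ^ (σ + y * I : ℂ) *
      LFunctionResidueClassAux a (σ + y * I) := by
  have hxc : (x : ℂ) ≠ 0 := by exact_mod_cast hx.ne'
  have hcont : Continuous fun y : ℝ => (σ + y * I : ℂ) := by fun_prop
  have hne : ∀ y : ℝ, σ - 1 ≤ ‖(σ + y * I - 1 : ℂ)‖ := fun y => by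
    refine le_trans ?_ (Complex.re_le_norm _)
    simp
  have hMx : Integrable fun y : ℝ => mellin g (σ + y * I) * (x : ℂ) ^ (σ + y * I : ℂ) := by
    refine (verticalIntegrable_mellin hc hg (by linarith) h2).mul_bdd (c := x ^ σ)
      (hcont.const_cpow (Or.inl hxc)).aestronglyMeasurable (.of_forall fun y => ?_)
    rw [Complex.norm_cpow_eq_rpow_re_of_pos hx]
    simp
  have hpole : Integrable fun y : ℝ => mellin g (σ + y * I) * (x : ℂ) ^ (σ + y * I : ℂ) *
      (1 / (σ + y * I - 1)) := by
    refine hMx.mul_bdd (c := 1 / (σ - 1)) ?_ (.of_forall fun y => ?_)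
    · refine (continuous_const.div (hcont.sub continuous_const) fun y h => ?_).aestronglyMeasurable
      have := hne y
      rw [show (σ + y * I - 1 : ℂ) = 0 from h, norm_zero] at this
      linarith
    · rw [norm_div, norm_one]
      exact one_div_le_one_div_of_le (by linarith) (hne y)
  have hsum : LSeriesSummable (fun n => (residueClass a n : ℂ)) σ := by
    refine LSeriesSummable_of_abscissaOfAbsConv_lt_re
      ((abscissaOfAbsConv_residueClass_le_one a).trans_lt ?_)
    simpa using (by exact_mod_cast h1 : (1 : EReal) < σ)
  rw [tsum_mul_eq_integral_mellin_mul_LSeries hc hg (by linarith) h2 hx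
    (by simp [residueClass_apply_zero]) hsum, integral_Ioi_one_eq_integral_mellin hc hg h1 h2 hx,
    mul_left_comm, ← mul_sub, ← integral_const_mul, sub_eq_iff_eq_add'.mpr]
  rw [← integral_add (hpole.const_mul _) hi]
  congr 1
  ext y
  rw [eqOn_LFunctionResidueClassAux ha (by simpa using h1)]
  ring

/-- The prime number theorem in arithmetic progressions, with classical error term, for smoothly
weighted sums. -/
lemma exists_tsum_residueClass_sub_isBigO (ha : IsUnit a) (hc : ContDiff ℝ (⊤ : ℕ∞) g)
    (hg : HasCompactSupport g) :
    ∃ c > (0 : ℝ), (fun x : ℝ => ∑' n, (residueClass a n : ℂ) * g (n / x) -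
      (q.totient : ℂ)⁻¹ * ∫ u in Set.Ioi (1 : ℝ), g (u / x)) =O[atTop]
      fun x : ℝ => x * Real.exp (-c * √(Real.log x)) := by
  obtain ⟨b, C, hb, hb4, hC, hH⟩ := exists_norm_LFunctionResidueClassAux_le a
  obtain ⟨D, hD, hM⟩ := exists_norm_mellin_mul_pow_le 5 hc hg
  refine ⟨b / 3, by positivity, IsBigO.of_bound
    ((π + 4) * (D * C * Real.exp 1) + π * (D * C)) ?_⟩
  filter_upwards [eventually_ge_atTop (Real.exp 1)] with x hx
  have hx1 : 1 ≤ x := (Real.one_le_exp zero_le_one).trans hx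
  have hx0 : 0 < x := by linarith
  have hxc : (x : ℂ) ≠ 0 := by exact_mod_cast hx0.ne'
  set L := Real.log x with hL
  have hL1 : 1 ≤ L := by rwa [hL, Real.le_log_iff_exp_le hx0]
  have hLs : √L * √L = L := Real.mul_self_sqrt (by linarith)
  have hL2 : 1 ≤ √L := Real.one_le_sqrt.mpr hL1
  set T := Real.exp √L with hT
  have hT0 : 0 < T := Real.exp_pos _
  have hT1 : 1 ≤ T := Real.one_le_exp (by positivity)
  set σ₀ : ℝ := 1 + 1 / L with hσ₀
  set σ₁ : ℝ := 1 - b / Real.log (T + 3) with hσ₁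
  have hL3 : 0 < 1 / L := by positivity
  have hL4 : 1 / L ≤ 1 := by rw [div_le_one (by linarith)]; exact hL1
  have hσ₀1 : 1 < σ₀ := by linarith
  have hσ₀2 : σ₀ ≤ 2 := by linarith
  have hlog1 : 1 ≤ Real.log (T + 3) := by
    have := one_le_log_abs_add_three T
    rwa [abs_of_pos hT0] at this
  have hbl : 0 < b / Real.log (T + 3) := by positivity
  have hbl' : b / Real.log (T + 3) ≤ b := div_le_self hb.le hlog1
  have hlog3 : Real.log (T + 3) ≤ 3 * √L := by
    rw [Real.log_le_iff_le_exp (by positivity)]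
    have e : (4 : ℝ) ≤ Real.exp 2 := by
      have h := Real.exp_one_gt_d9
      have : Real.exp 2 = Real.exp 1 * Real.exp 1 := by rw [← Real.exp_add]; norm_num
      nlinarith
    calc T + 3 ≤ 4 * T := by linarith
      _ ≤ Real.exp 2 * T := by gcongr
      _ = Real.exp (2 + √L) := by rw [Real.exp_add]
      _ ≤ Real.exp (3 * √L) := Real.exp_le_exp.mpr (by linarith)
  -- the region used lies inside the zero-free region
  have hreg : ∀ s : ℂ, σ₁ ≤ s.re → |s.im| ≤ T → 1 - b / Real.log (|s.im| + 3) ≤ s.re := by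
    intro s h1 h2
    refine le_trans ?_ h1
    have := one_le_log_abs_add_three s.im
    have : Real.log (|s.im| + 3) ≤ Real.log (T + 3) :=
      Real.log_le_log (by positivity) (by linarith)
    rw [hσ₁]
    gcongr
  set K : ℂ → ℂ := fun s => mellin g s * (x : ℂ) ^ s * LFunctionResidueClassAux a s with hK
  have hKd : ∀ s : ℂ, 1 / 2 ≤ s.re → s.re ≤ 2 → 1 - b / Real.log (|s.im| + 3) ≤ s.re →
      DifferentiableAt ℂ K s := fun s h1 h2 h3 =>
    ((differentiableAt_mellin_of_hasCompactSupport hc.continuous hg (by linarith)).mul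
      (differentiableAt_id.const_cpow (Or.inl hxc))).mul (hH s h3 h2).1
  have hKb : ∀ s : ℂ, 1 / 2 ≤ s.re → s.re ≤ 2 → 1 - b / Real.log (|s.im| + 3) ≤ s.re →
      ‖K s‖ * ((1 + s.im ^ 2) * (|s.im| + 3)) ≤ D * C * x ^ s.re := by
    intro s h1 h2 h3
    have h4 := hM s h1 h2
    have h5 := (hH s h3 h2).2
    have h6 := abs_nonneg s.im
    have h7 : 1 + s.im ^ 2 ≤ (|s.im| + 3) ^ 2 := by nlinarith [sq_abs s.im]
    rw [hK, norm_mul, norm_mul, Complex.norm_cpow_eq_rpow_re_of_pos hx0]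
    calc ‖mellin g s‖ * x ^ s.re * ‖LFunctionResidueClassAux a s‖ *
          ((1 + s.im ^ 2) * (|s.im| + 3))
        ≤ ‖mellin g s‖ * x ^ s.re * (C * (|s.im| + 3) ^ 2) *
          ((|s.im| + 3) ^ 2 * (|s.im| + 3)) := by gcongr
      _ = ‖mellin g s‖ * (|s.im| + 3) ^ 5 * C * x ^ s.re := by ring
      _ ≤ _ := by gcongr
  have hKb' : ∀ s : ℂ, 1 / 2 ≤ s.re → s.re ≤ 2 → 1 - b / Real.log (|s.im| + 3) ≤ s.re →
      ‖K s‖ ≤ D * C * x ^ s.re * (1 + s.im ^ 2)⁻¹ := by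
    intro s h1 h2 h3
    rw [← div_eq_mul_inv, le_div_iff₀ (by positivity)]
    refine le_trans ?_ (hKb s h1 h2 h3)
    have h6 := abs_nonneg s.im
    gcongr
    exact le_mul_of_one_le_right (by positivity) (by linarith)
  have hline : ∀ y : ℝ, 1 - b / Real.log (|(σ₀ + y * I : ℂ).im| + 3) ≤ (σ₀ + y * I : ℂ).re := by
    intro y
    have := one_le_log_abs_add_three (σ₀ + y * I : ℂ).im
    have : 0 < b / Real.log (|(σ₀ + y * I : ℂ).im| + 3) := by positivity
    simp only [add_re, ofReal_re, mul_re, I_re, mul_zero, ofReal_im, I_im, mul_one, sub_self,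
      add_zero]
    linarith
  have hre : ∀ σ y : ℝ, (σ + y * I : ℂ).re = σ := by simp
  have him : ∀ σ y : ℝ, (σ + y * I : ℂ).im = y := by simp
  have hint : Integrable fun y : ℝ => K (σ₀ + y * I) := by
    refine (integrable_inv_one_add_sq.const_mul (D * C * x ^ σ₀)).mono' ?_
      (.of_forall fun y => ?_)
    · refine Continuous.aestronglyMeasurable (continuous_iff_continuousAt.mpr fun y => ?_)
      refine ContinuousAt.comp (g := K) (f := fun y : ℝ => (σ₀ + y * I : ℂ)) ?_
        (by fun_prop : Continuous fun y : ℝ => (σ₀ + y * I : ℂ)).continuousAt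
      exact (hKd _ (by rw [hre]; linarith) (by rwa [hre]) (hline y)).continuousAt
    · have := hKb' (σ₀ + y * I) (by rw [hre]; linarith) (by rwa [hre]) (hline y)
      rwa [hre, him] at this
  have hx₀ : x ^ σ₀ = x * Real.exp 1 := by
    rw [hσ₀, Real.rpow_add hx0, Real.rpow_one, Real.rpow_def_of_pos hx0, ← hL,
      mul_one_div_cancel (by linarith)]
  have hx₁ : x ^ σ₁ ≤ x * Real.exp (-(b / 3) * √L) := by
    rw [hσ₁, sub_eq_add_neg, Real.rpow_add hx0, Real.rpow_one, Real.rpow_def_of_pos hx0, ← hL]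
    refine mul_le_mul_of_nonneg_left (Real.exp_le_exp.mpr ?_) hx0.le
    have : b / 3 * √L ≤ L * (b / Real.log (T + 3)) := by
      rw [← mul_div_assoc, le_div_iff₀ (by linarith)]
      calc b / 3 * √L * Real.log (T + 3) ≤ b / 3 * √L * (3 * √L) := by gcongr
        _ = L * b := by linear_combination b * hLs
    linarith
  have hxT : x ^ σ₀ / T ≤ x * Real.exp 1 * Real.exp (-(b / 3) * √L) := by
    rw [hx₀, div_eq_mul_inv, hT, ← Real.exp_neg]
    gcongr
    nlinarith
  have hmain := norm_integral_vertical_le (K := K) (σ₁ := σ₁) (σ₀ := σ₀) (T := T)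
    (A := D * C * x ^ σ₀) (A₁ := D * C * x ^ σ₁) (by linarith) (by linarith) hT0 (by positivity)
    (by positivity) (fun s h1 h2 h3 => hKd s (by linarith) (by linarith) (hreg s h1 h3)) hint
    (fun y hy => ?_) (fun s h1 h2 h3 => ?_) (fun y hy => ?_)
  · rw [tsum_residueClass_sub_eq_integral ha hc hg hσ₀1 hσ₀2 hx0 hint, norm_mul, norm_real,
      Real.norm_of_nonneg (by positivity : 0 ≤ x * Real.exp (-(b / 3) * √L)),
      Real.norm_of_nonneg (by positivity : 0 ≤ 1 / (2 * π))]
    refine (mul_le_of_le_one_left (norm_nonneg _) ?_).trans (hmain.trans ?_)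
    · rw [div_le_one (by positivity)]
      linarith [Real.pi_gt_three]
    · calc (π + 4) * (D * C * x ^ σ₀ / T) + π * (D * C * x ^ σ₁)
          = (π + 4) * (D * C * (x ^ σ₀ / T)) + π * (D * C * x ^ σ₁) := by ring
        _ ≤ (π + 4) * (D * C * (x * Real.exp 1 * Real.exp (-(b / 3) * √L))) +
            π * (D * C * (x * Real.exp (-(b / 3) * √L))) := by gcongr
        _ = _ := by ring
  · have := hKb (σ₀ + y * I) (by rw [hre]; linarith) (by rwa [hre]) (hline y)
    rw [hre, him] at this
    rw [← div_eq_mul_inv, div_div, le_div_iff₀ (by positivity)]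
    refine le_trans ?_ this
    rw [mul_comm T]
    gcongr
    linarith
  · have := hKb s (by linarith) (by linarith) (hreg s h1 h3.le)
    rw [le_div_iff₀ hT0]
    calc ‖K s‖ * T ≤ ‖K s‖ * ((1 + s.im ^ 2) * (|s.im| + 3)) := by
          rw [h3]
          gcongr
          nlinarith [sq_nonneg s.im]
      _ ≤ D * C * x ^ s.re := this
      _ ≤ _ := by gcongr
  · have := hKb' (σ₁ + y * I) (by rw [hre]; linarith) (by rw [hre]; linarith)
      (hreg _ (hre _ _).ge (by rwa [him]))
    rwa [hre, him] at this

end ResidueClass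

/-! ### Ideals of the Gaussian integers -/

section GaussianIdeals

open Ideal

/-- The `ℤ`-linear coordinates on the Gaussian integers. -/
def gaussianIntBasis : Module.Basis (Fin 2) ℤ GaussianInt :=
  Module.Basis.ofEquivFun
    { toFun := fun z => ![z.re, z.im]
      invFun := fun v => ⟨v 0, v 1⟩
      map_add' := fun x y => by ext i; fin_cases i <;> simp
      map_smul' := fun c x => by ext i; fin_cases i <;> simp
      left_inv := fun z => by simp
      right_inv := fun v => by ext i; fin_cases i <;> simp }

instance : Module.Free ℤ GaussianInt := .of_basis gaussianIntBasis

instance : Module.Finite ℤ GaussianInt := .of_basis gaussianIntBasis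

lemma finrank_gaussianInt : Module.finrank ℤ GaussianInt = 2 := by
  simpa using Module.finrank_eq_card_basis gaussianIntBasis

lemma idealNorm_eq_absNorm (I : Ideal GaussianInt) : idealNorm I = absNorm I := rfl

lemma idealNorm_span_natCast (n : ℕ) : idealNorm (span {(n : GaussianInt)}) = n ^ 2 := by
  rw [idealNorm_eq_absNorm, absNorm_span_natCast, finrank_gaussianInt]

lemma idealLambda_span_natCast_nonneg (n : ℕ) : 0 ≤ idealLambda (span {(n : GaussianInt)}) := by
  rw [idealLambda]
  split_ifs
  · exact Real.log_natCast_nonneg _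
  · rfl

lemma idealLambda_span_natCast_le (n : ℕ) :
    idealLambda (span {(n : GaussianInt)}) ≤ 2 * Real.log n := by
  rw [idealLambda]
  split_ifs with h
  · obtain ⟨r, hP, hP0, hr, hn⟩ := h.choose_spec
    set P := h.choose
    have h1 : n ^ 2 = idealNorm P ^ r := by
      rw [← idealNorm_span_natCast, hn, idealNorm_eq_absNorm, idealNorm_eq_absNorm, map_pow]
    have h2 : 0 < idealNorm P := Nat.pos_of_ne_zero (absNorm_eq_zero_iff.not.mpr hP0)
    have h3 : idealNorm P ≤ n ^ 2 := h1 ▸ Nat.le_self_pow hr.ne' _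
    calc Real.log (idealNorm P) ≤ Real.log ((n : ℝ) ^ 2) :=
          Real.log_le_log (by exact_mod_cast h2) (by exact_mod_cast h3)
      _ = _ := by rw [Real.log_pow]; norm_num
  · have := Real.log_natCast_nonneg n
    positivity

lemma idealLambda_bot : idealLambda ⊥ = 0 := by
  rw [idealLambda, dif_neg]
  rintro ⟨P, r, hP, hP0, hr, h⟩
  exact hP0 (pow_eq_zero_iff hr.ne' |>.mp h.symm)

/-- If two natural numbers lie in a proper ideal, they are not coprime. -/
lemma not_coprime_of_natCast_mem {P : Ideal GaussianInt} (hP : P ≠ ⊤) {a b : ℕ}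
    (ha : (a : GaussianInt) ∈ P) (hb : (b : GaussianInt) ∈ P) : ¬ a.Coprime b := by
  intro h
  apply hP
  rw [Ideal.eq_top_iff_one]
  have h1 := Nat.isCoprime_iff_coprime.mpr h
  obtain ⟨u, v, huv⟩ := h1
  have h2 : (u : GaussianInt) * a + v * b = 1 := by
    exact_mod_cast congrArg (Int.cast (R := GaussianInt)) huv
  rw [← h2]
  exact add_mem (P.mul_mem_left _ ha) (P.mul_mem_left _ hb)

/-- An element dividing a rational integer that generates a power of a prime ideal `P` is either a
unit or lies in `P`. -/
lemma mem_of_dvd_of_span_eq_pow {P : Ideal GaussianInt} (hP : P.IsPrime) (hP0 : P ≠ ⊥) {n r : ℕ}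
    (hn : span {(n : GaussianInt)} = P ^ r) {z : GaussianInt} (hz : ¬ IsUnit z)
    (hd : z ∣ n) : z ∈ P := by
  obtain ⟨Q, hQ, hzQ⟩ := exists_max_ideal_of_mem_nonunits hz
  have h1 : P ^ r ≤ Q := by
    rw [← hn, span_singleton_le_iff_mem]
    exact Q.mem_of_dvd hd hzQ
  have h2 : P ≤ Q := hQ.isPrime.le_of_pow_le h1
  rwa [(hP.isMaximal hP0).eq_of_le hQ.ne_top h2]

lemma exists_prime_pow_of_span_natCast_eq_pow {P : Ideal GaussianInt} (hP : P.IsPrime)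
    (hP0 : P ≠ ⊥) {n r : ℕ} (hn0 : n ≠ 0) (hr : 0 < r) (hn : span {(n : GaussianInt)} = P ^ r) :
    ∃ p k : ℕ, p.Prime ∧ n = p ^ k ∧ (p : GaussianInt) ∈ P ∧ p % 4 ≠ 1 := by
  have hunit : ∀ p : ℕ, p.Prime → ¬ IsUnit (p : GaussianInt) := by
    intro p hp h
    rw [Zsqrtd.isUnit_iff_norm_isUnit, Zsqrtd.norm_natCast] at h
    have := isUnit_of_mul_isUnit_left h
    rw [Int.isUnit_iff] at this
    have := hp.two_le
    omega
  have hmem : ∀ p : ℕ, p.Prime → p ∣ n → (p : GaussianInt) ∈ P := fun p hp hd =>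
    mem_of_dvd_of_span_eq_pow hP hP0 hn (hunit p hp) (Nat.cast_dvd_cast hd)
  have hn1 : n ≠ 1 := by
    rintro rfl
    rw [Nat.cast_one, span_singleton_one] at hn
    exact hP.ne_top (top_le_iff.mp (hn ▸ pow_le_self hr.ne'))
  obtain ⟨p, hp, hpn⟩ := Nat.exists_prime_and_dvd hn1
  have hpP := hmem p hp hpn
  refine ⟨p, n.primeFactorsList.length, hp, Nat.eq_prime_pow_of_unique_prime_dvd hn0 ?_, hpP, ?_⟩
  · intro l hl hln
    by_contra h
    exact not_coprime_of_natCast_mem hP.ne_top (hmem l hl hln) hpP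
      ((Nat.coprime_primes hl hp).mpr h)
  · intro hp4
    have := Fact.mk hp
    obtain ⟨a, b, hab⟩ := Nat.Prime.sq_add_sq (p := p) (by omega)
    have hunit' : ∀ c d : ℤ, c ^ 2 + d ^ 2 = p → ¬ IsUnit (⟨c, d⟩ : GaussianInt) := by
      intro c d hcd h
      rw [Zsqrtd.isUnit_iff_norm_isUnit, Zsqrtd.norm_def, Int.isUnit_iff] at h
      have := hp.two_le
      simp only at h
      have : c * c - -1 * d * d = p := by linear_combination hcd
      omega
    have hab' : (a : ℤ) ^ 2 + (b : ℤ) ^ 2 = p := by exact_mod_cast hab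
    have hmul : (⟨a, b⟩ : GaussianInt) * ⟨a, -b⟩ = (p : GaussianInt) := by
      ext
      · simp; linear_combination hab'
      · simp; ring
    have hdn : (p : GaussianInt) ∣ n := Nat.cast_dvd_cast hpn
    have h1 := mem_of_dvd_of_span_eq_pow hP hP0 hn (hunit' a b hab') ((Dvd.intro _ hmul).trans hdn)
    have h2 := mem_of_dvd_of_span_eq_pow hP hP0 hn
      (hunit' a (-b) (by linear_combination hab')) ((Dvd.intro_left _ hmul).trans hdn)
    have h3 : ((2 * a : ℕ) : GaussianInt) ∈ P := by
      convert add_mem h1 h2 using 1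
      ext
      · simp; ring
      · simp
    refine not_coprime_of_natCast_mem hP.ne_top h3 hpP ?_
    rw [Nat.coprime_comm, hp.coprime_iff_not_dvd, hp.dvd_mul]
    rintro (h | h)
    · have := Nat.le_of_dvd two_pos h
      have := hp.two_le
      interval_cases p
      omega
    · have ha : 0 < a := by
        rcases Nat.eq_zero_or_pos a with rfl | ha
        · exact absurd ⟨b, by rw [← hab]; ring⟩ (Irreducible.not_isSquare hp)
        · exact ha
      have := Nat.le_of_dvd ha h
      nlinarith [hp.two_le]

lemma isPrime_span_natCast {p : ℕ} (hp : p.Prime) (h : p % 4 = 3) :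
    (span {(p : GaussianInt)}).IsPrime := by
  have := Fact.mk hp
  rw [span_singleton_prime (by exact_mod_cast hp.ne_zero)]
  exact GaussianInt.prime_of_nat_prime_of_mod_four_eq_three p h

lemma idealLambda_span_natCast_eq {n : ℕ} (h1 : ¬ IsSquare n) (h2 : ∀ m, n ≠ 2 * m ^ 2) :
    idealLambda (span {(n : GaussianInt)}) =
      2 * ArithmeticFunction.vonMangoldt.residueClass (3 : ZMod 4) n := by
  have hn0 : n ≠ 0 := by
    rintro rfl
    exact h1 ⟨0, rfl⟩
  have hres : ArithmeticFunction.vonMangoldt.residueClass (3 : ZMod 4) n =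
      if n % 4 = 3 then ArithmeticFunction.vonMangoldt n else 0 := by
    have hcast : (n : ZMod 4) = 3 ↔ n % 4 = 3 :=
      ZMod.natCast_eq_natCast_iff' n 3 4
    rw [ArithmeticFunction.vonMangoldt.residueClass, Set.indicator_apply]
    simp only [Set.mem_ofPred_eq, hcast]
  rw [hres, idealLambda]
  by_cases h : ∃ P : Ideal GaussianInt, ∃ r : ℕ, P.IsPrime ∧ P ≠ ⊥ ∧ 0 < r ∧
      span {(n : GaussianInt)} = P ^ r
  · rw [dif_pos h]
    obtain ⟨r, hP, hP0, hr, hn⟩ := h.choose_spec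
    set P := h.choose
    obtain ⟨p, k, hp, hpk, hpP, hp4⟩ := exists_prime_pow_of_span_natCast_eq_pow hP hP0 hn0 hr hn
    obtain ⟨j, hj⟩ : Odd k := by
      rw [← Nat.not_even_iff_odd]
      rintro ⟨j, hj⟩
      exact h1 ⟨p ^ j, by rw [hpk, hj, pow_add]⟩
    have hp3 : p % 4 = 3 := by
      rcases hp.eq_two_or_odd with rfl | hodd
      · exact absurd (by rw [hpk, hj]; ring) (h2 (2 ^ j))
      · omega
    have hn3 : n % 4 = 3 := by
      have : p ^ 2 % 4 = 1 := by rw [Nat.pow_mod, hp3]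
      rw [hpk, hj, pow_succ, pow_mul, Nat.mul_mod, Nat.pow_mod, this, hp3, one_pow]
      rfl
    have hPp : span {(p : GaussianInt)} = P :=
      ((isPrime_span_natCast hp hp3).isMaximal (by simpa using hp.ne_zero)).eq_of_le hP.ne_top
        ((span_singleton_le_iff_mem _).mpr hpP)
    rw [if_pos hn3, ← hPp, idealNorm_span_natCast, hpk,
      ArithmeticFunction.vonMangoldt_apply_pow (by omega),
      ArithmeticFunction.vonMangoldt_apply_prime hp, Nat.cast_pow, Real.log_pow]
    norm_num
  · rw [dif_neg h, eq_comm, mul_eq_zero, or_iff_right two_ne_zero, ite_eq_right_iff]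
    intro hn3
    by_contra hne
    rw [← Ne, ArithmeticFunction.vonMangoldt_ne_zero_iff, isPrimePow_nat_iff] at hne
    obtain ⟨p, k, hp, hk, hpk⟩ := hne
    have hp3 : p % 4 = 3 := by
      rcases hp.eq_two_or_odd with rfl | hodd
      · have : 2 ∣ n := hpk ▸ dvd_pow_self 2 hk.ne'
        omega
      · by_contra hp3
        have : p % 4 = 1 := by omega
        rw [← hpk, Nat.pow_mod, this, one_pow] at hn3
        omega
    refine h ⟨span {(p : GaussianInt)}, k, isPrime_span_natCast hp hp3,
      by simpa using hp.ne_zero, hk, ?_⟩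
    rw [span_singleton_pow, ← hpk, Nat.cast_pow]

/-- The ideals of angle zero are those generated by a positive rational integer. -/
lemma idealTheta_span_natCast {n : ℕ} (hn : n ≠ 0) :
    idealTheta (span {(n : GaussianInt)}) = 0 := by
  have hnpos : (0 : ℤ) < n := by exact_mod_cast Nat.pos_of_ne_zero hn
  have h : ∃ α : GaussianInt, span {α} = span {(n : GaussianInt)} ∧
      (GaussianInt.toComplex α).arg ∈ Set.Ico 0 (π / 2) :=
    ⟨n, rfl, by rw [map_natCast, Complex.natCast_arg]; exact ⟨le_rfl, by positivity⟩⟩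
  rw [idealTheta, dif_pos h]
  obtain ⟨hα, h0, h1⟩ := h.choose_spec
  set α := h.choose
  rw [Complex.arg_nonneg_iff, ← GaussianInt.intCast_im] at h0
  rw [Complex.arg_lt_pi_div_two_iff, ← GaussianInt.intCast_im, ← GaussianInt.intCast_re,
    GaussianInt.toComplex_eq_zero] at h1
  rw [Complex.arg_eq_zero_iff, ← GaussianInt.intCast_im, ← GaussianInt.intCast_re]
  rw [span_singleton_eq_span_singleton] at hα
  obtain ⟨u, hu⟩ := hα.symm
  have hu1 : (u : GaussianInt).norm = 1 :=
    (Zsqrtd.norm_eq_one_iff' (by norm_num) _).mpr u.isUnit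
  rw [Zsqrtd.norm_def] at hu1
  have hre : α.re = n * (u : GaussianInt).re := by rw [← hu]; simp
  have him : α.im = n * (u : GaussianInt).im := by rw [← hu]; simp
  have hα0 : α ≠ 0 := by
    intro h
    rw [h, mul_eq_zero, or_iff_left u.ne_zero] at hu
    exact hn (by exact_mod_cast hu)
  norm_cast at h0 h1 ⊢
  have h2 : 0 < α.re := by
    rcases h1 with h1 | h1 | h1
    · exact h1
    · exact absurd h1 (not_lt.mpr h0)
    · exact absurd h1 hα0
  rw [hre] at h2
  rw [him] at h0 ⊢
  refine ⟨by rw [hre]; exact h2.le, ?_⟩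
  have h3 := pos_of_mul_pos_right h2 hnpos.le
  have h4 : (u : GaussianInt).im = 0 := by nlinarith
  rw [h4, mul_zero]

lemma exists_span_natCast_of_idealTheta_eq_zero {I : Ideal GaussianInt} (hI : I ≠ ⊥)
    (hθ : idealTheta I = 0) : ∃ n : ℕ, n ≠ 0 ∧ span {(n : GaussianInt)} = I := by
  have h : ∃ α : GaussianInt, span {α} = I ∧
      (GaussianInt.toComplex α).arg ∈ Set.Ico 0 (π / 2) := by
    obtain ⟨β, rfl⟩ := (IsPrincipalIdealRing.principal I).principal
    have hβ : β ≠ 0 := by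
      rintro rfl
      simp at hI
    have key : ∀ c d : ℤ, 0 < c → 0 ≤ d → Associated (⟨c, d⟩ : GaussianInt) β →
        ∃ α : GaussianInt, span {α} = span {β} ∧
          (GaussianInt.toComplex α).arg ∈ Set.Ico 0 (π / 2) := by
      intro c d hc hd hu
      refine ⟨⟨c, d⟩, span_singleton_eq_span_singleton.mpr hu, ?_, ?_⟩
      · rw [Complex.arg_nonneg_iff, GaussianInt.im_toComplex]
        exact_mod_cast hd
      · rw [Complex.arg_lt_pi_div_two_iff, GaussianInt.re_toComplex]
        exact Or.inl (by exact_mod_cast hc)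
    have hunit : ∀ a b : ℤ, a ^ 2 + b ^ 2 = 1 → IsUnit (⟨a, b⟩ : GaussianInt) := by
      intro a b hab
      rw [← Zsqrtd.norm_eq_one_iff' (by norm_num), Zsqrtd.norm_def]
      linear_combination hab
    have hassoc : ∀ c d a b : ℤ, a ^ 2 + b ^ 2 = 1 → β = ⟨c * a - d * b, c * b + d * a⟩ →
        Associated (⟨c, d⟩ : GaussianInt) β := by
      intro c d a b hab hβ'
      refine ⟨(hunit a b hab).unit, ?_⟩
      rw [IsUnit.unit_spec, hβ']
      ext
      · simp; ring
      · simp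
    have hne : ¬ (β.re = 0 ∧ β.im = 0) := fun h0 => hβ (Zsqrtd.ext h0.1 h0.2)
    change ∃ α : GaussianInt, span {α} = span {β} ∧ _
    by_cases h1 : 0 < β.re ∧ 0 ≤ β.im
    · exact key β.re β.im h1.1 h1.2 (hassoc _ _ 1 0 (by norm_num) (by ext <;> simp))
    by_cases h2 : β.re ≤ 0 ∧ 0 < β.im
    · exact key β.im (-β.re) h2.2 (by omega) (hassoc _ _ 0 1 (by norm_num) (by ext <;> simp))
    by_cases h3 : β.re < 0 ∧ β.im ≤ 0
    · exact key (-β.re) (-β.im) (by omega) (by omega)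
        (hassoc _ _ (-1) 0 (by norm_num) (by ext <;> simp))
    · exact key (-β.im) β.re (by omega) (by omega)
        (hassoc _ _ 0 (-1) (by norm_num) (by ext <;> simp))
  rw [idealTheta, dif_pos h] at hθ
  have hα := h.choose_spec.1
  set α := h.choose
  rw [Complex.arg_eq_zero_iff, ← GaussianInt.intCast_im, ← GaussianInt.intCast_re] at hθ
  norm_cast at hθ
  have hαn : α = (α.re.toNat : GaussianInt) := by
    ext
    · simp [hθ.1]
    · simp [hθ.2]
  refine ⟨α.re.toNat, ?_, by rw [← hαn, hα]⟩
  intro h0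
  rw [h0, Nat.cast_zero] at hαn
  rw [hαn, span_singleton_eq_bot.mpr rfl] at hα
  exact hI hα.symm

/-- The sum over ideals of angle zero as a sum over rational integers. -/
lemma inertSum_eq_tsum (Φ : ℝ → ℝ) (X : ℝ) :
    inertSum Φ X = ∑' n : ℕ, idealLambda (span {(n : GaussianInt)}) * Φ ((n : ℝ) ^ 2 / X) := by
  let e : {n : ℕ | n ≠ 0} → {I : Ideal GaussianInt // I ≠ ⊥ ∧ idealTheta I = 0} := fun n =>
    ⟨span {((n : ℕ) : GaussianInt)}, fun h => n.2 (by exact_mod_cast span_singleton_eq_bot.mp h),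
      idealTheta_span_natCast n.2⟩
  have he : Function.Bijective e := by
    refine ⟨fun n m h => ?_, fun I => ?_⟩
    · have h1 := congrArg (fun I => idealNorm I.1) h
      simp only [e, idealNorm_span_natCast] at h1
      exact Subtype.ext (Nat.pow_left_injective two_ne_zero h1)
    · obtain ⟨n, hn, hI⟩ := exists_span_natCast_of_idealTheta_eq_zero I.2.1 I.2.2
      exact ⟨⟨n, hn⟩, Subtype.ext hI⟩
  rw [inertSum, ← (Equiv.ofBijective e he).tsum_eq]
  simp only [Equiv.ofBijective_apply, e, idealNorm_span_natCast, Nat.cast_pow]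
  refine tsum_subtype_eq_of_support_subset
    (f := fun n : ℕ => idealLambda (span {(n : GaussianInt)}) * Φ ((n : ℝ) ^ 2 / X)) ?_
  intro n hn h0
  apply hn
  simp [show n = 0 from h0, idealLambda_bot, Set.singleton_zero]

end GaussianIdeals

/-! ### The asymptotic formula -/

lemma card_filter_isSquare_or_two_mul_le (N : ℕ) :
    (((Finset.range (N + 1)).filter fun n => IsSquare n ∨ ∃ m, n = 2 * m ^ 2).card : ℝ) ≤
      2 * (√(N : ℝ) + 1) := by
  have h : ((Finset.range (N + 1)).filter fun n => IsSquare n ∨ ∃ m, n = 2 * m ^ 2) ⊆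
      (Finset.range (N.sqrt + 1)).image (fun m => m * m) ∪
      (Finset.range (N.sqrt + 1)).image (fun m => 2 * m ^ 2) := by
    intro n hn
    simp only [Finset.mem_filter, Finset.mem_range, Nat.lt_succ_iff] at hn
    simp only [Finset.mem_union, Finset.mem_image, Finset.mem_range, Nat.lt_succ_iff, Nat.le_sqrt]
    obtain ⟨hN, ⟨m, rfl⟩ | ⟨m, rfl⟩⟩ := hn
    · exact Or.inl ⟨m, hN, rfl⟩
    · exact Or.inr ⟨m, by nlinarith, rfl⟩
  have h1 := (Finset.card_le_card h).trans ((Finset.card_union_le _ _).trans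
    (add_le_add Finset.card_image_le Finset.card_image_le))
  rw [Finset.card_range] at h1
  have h2 : ((N.sqrt : ℕ) : ℝ) ≤ √(N : ℝ) := Real.nat_sqrt_le_real_sqrt
  have h3 : (((Finset.range (N + 1)).filter fun n => IsSquare n ∨ ∃ m, n = 2 * m ^ 2).card : ℝ) ≤
      (N.sqrt + 1) + (N.sqrt + 1) := by exact_mod_cast h1
  linarith

section Weighted

variable {g : ℝ → ℝ}

lemma exists_forall_gt_eq_zero (hg : HasCompactSupport g) :
    ∃ R : ℝ, 1 ≤ R ∧ ∀ u, R < u → g u = 0 := by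
  obtain ⟨R, hR⟩ := hg.isCompact.bddAbove
  refine ⟨max R 1, le_max_right _ _, fun u hu => ?_⟩
  by_contra h
  exact absurd (hR (subset_tsupport g h)) (not_le.mpr ((le_max_left _ _).trans_lt hu))

lemma mul_apply_div_eq_zero {R : ℝ} (hR : ∀ u, R < u → g u = 0) (f : ℕ → ℝ) {x : ℝ} (hx : 0 < x)
    {n : ℕ} (hn : n ∉ Finset.range (⌊R * x⌋₊ + 1)) : f n * g (n / x) = 0 := by
  rw [hR, mul_zero]
  rw [Finset.mem_range, not_lt, Nat.succ_le_iff] at hn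
  rw [lt_div_iff₀ hx]
  exact Nat.lt_of_floor_lt hn

lemma summable_mul_apply_div (hg : HasCompactSupport g) (f : ℕ → ℝ) {x : ℝ} (hx : 0 < x) :
    Summable fun n : ℕ => f n * g (n / x) := by
  obtain ⟨R, -, hR⟩ := exists_forall_gt_eq_zero hg
  exact summable_of_ne_finset_zero fun n hn => mul_apply_div_eq_zero hR f hx hn

/-- Coefficients supported on squares and doubled squares contribute little. -/
lemma tsum_mul_apply_div_isBigO (hc : Continuous g) (hg : HasCompactSupport g) {d : ℕ → ℝ}
    (hd : ∀ n, |d n| ≤ 2 * Real.log n)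
    (hd0 : ∀ n, d n ≠ 0 → IsSquare n ∨ ∃ m, n = 2 * m ^ 2) :
    (fun x : ℝ => ∑' n : ℕ, d n * g (n / x)) =O[atTop] fun x : ℝ => x ^ (3 / 4 : ℝ) := by
  obtain ⟨R, hR1, hR⟩ := exists_forall_gt_eq_zero hg
  obtain ⟨G, hG⟩ := hg.exists_bound_of_continuous hc
  have hG0 : 0 ≤ G := (norm_nonneg _).trans (hG 0)
  refine IsBigO.of_bound (32 * G * R ^ (3 / 4 : ℝ)) ?_
  filter_upwards [eventually_ge_atTop 1] with x hx
  have hx0 : 0 < x := by linarith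
  set y := R * x with hy
  have hy1 : 1 ≤ y := by nlinarith
  have hy0 : 0 < y := by linarith
  rw [tsum_eq_sum fun n hn => mul_apply_div_eq_zero hR d hx0 hn,
    ← Finset.sum_filter_of_ne (p := fun n => IsSquare n ∨ ∃ m, n = 2 * m ^ 2)
      fun n _ hn => hd0 n (left_ne_zero_of_mul hn)]
  have hterm : ∀ n ∈ (Finset.range (⌊y⌋₊ + 1)).filter (fun n => IsSquare n ∨ ∃ m, n = 2 * m ^ 2),
      ‖d n * g (n / x)‖ ≤ 2 * Real.log y * G := by
    intro n hn
    have hn1 := (Finset.mem_filter.mp hn).1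
    rw [Finset.mem_range, Nat.lt_succ_iff] at hn1
    rw [norm_mul]
    refine mul_le_mul ((hd n).trans ?_) (hG _) (norm_nonneg _)
      (mul_nonneg zero_le_two (Real.log_nonneg hy1))
    rcases Nat.eq_zero_or_pos n with rfl | hn0
    · simpa using Real.log_nonneg hy1
    · have : (n : ℝ) ≤ y := (Nat.cast_le.mpr hn1).trans (Nat.floor_le hy0.le)
      have : Real.log n ≤ Real.log y := Real.log_le_log (by exact_mod_cast hn0) this
      linarith
  refine (norm_sum_le_of_le _ hterm).trans ?_
  rw [Finset.sum_const, nsmul_eq_mul, Real.norm_of_nonneg (by positivity)]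
  have hcard := card_filter_isSquare_or_two_mul_le ⌊y⌋₊
  have h1 : √(⌊y⌋₊ : ℝ) ≤ y ^ (1 / 2 : ℝ) := by
    rw [← Real.sqrt_eq_rpow]
    exact Real.sqrt_le_sqrt (Nat.floor_le hy0.le)
  have h2 : 1 ≤ y ^ (1 / 2 : ℝ) := Real.one_le_rpow hy1 (by norm_num)
  have h3 : Real.log y ≤ y ^ (1 / 4 : ℝ) / (1 / 4) := Real.log_le_rpow_div hy0.le (by norm_num)
  have h4 : y ^ (1 / 2 : ℝ) * y ^ (1 / 4 : ℝ) = R ^ (3 / 4 : ℝ) * x ^ (3 / 4 : ℝ) := by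
    rw [← Real.rpow_add hy0, ← Real.mul_rpow (by linarith) hx0.le]
    norm_num [hy]
  have h5 := Real.log_nonneg hy1
  calc _ ≤ (4 * y ^ (1 / 2 : ℝ)) * (2 * (y ^ (1 / 4 : ℝ) / (1 / 4)) * G) := by
        gcongr
        linarith
    _ = 32 * G * (y ^ (1 / 2 : ℝ) * y ^ (1 / 4 : ℝ)) := by ring
    _ = _ := by rw [h4]; ring

lemma integral_Ioi_one_comp_div_sub_isBigO (hc : Continuous g) (hg : HasCompactSupport g) :
    (fun x : ℝ => (∫ u in Set.Ioi (1 : ℝ), g (u / x)) - x * ∫ u in Set.Ioi (0 : ℝ), g u)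
      =O[atTop] fun _ => (1 : ℝ) := by
  obtain ⟨G, hG⟩ := hg.exists_bound_of_continuous hc
  refine IsBigO.of_bound G ?_
  filter_upwards [eventually_gt_atTop 0] with x hx
  have h1 : ∫ u in Set.Ioi (0 : ℝ), g (u / x) = x * ∫ u in Set.Ioi (0 : ℝ), g u := by
    have := integral_comp_mul_left_Ioi g 0 (inv_pos.mpr hx)
    simpa [div_eq_inv_mul] using this
  have hi : Integrable fun u => g (u / x) :=
    (hc.integrable_of_hasCompactSupport hg).comp_div hx.ne'
  have h2 := setIntegral_union (μ := volume) (f := fun u => g (u / x)) (s := Set.Ioc 0 1)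
    (t := Set.Ioi 1)
    Set.Ioc_disjoint_Ioi_same measurableSet_Ioi hi.integrableOn hi.integrableOn
  rw [Set.Ioc_union_Ioi_eq_Ioi zero_le_one, h1] at h2
  rw [h2, sub_add_cancel_right, norm_neg, norm_one, mul_one]
  simpa using norm_setIntegral_le_of_norm_le_const (μ := volume) (s := Set.Ioc (0 : ℝ) 1)
    (C := G) (by simp) fun u _ => hG (u / x)

end Weighted

lemma integral_Ioi_comp_sq (Φ : ℝ → ℝ) :
    ∫ u in Set.Ioi (0 : ℝ), Φ (u ^ 2) = mellinR Φ (1 / 2) / 2 := by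
  have h := integral_comp_rpow_Ioi (fun y => Φ y * y ^ ((1 / 2 : ℝ) - 1)) (p := 2) two_ne_zero
  rw [mellinR, ← h, eq_div_iff two_ne_zero, ← integral_mul_const]
  refine setIntegral_congr_fun measurableSet_Ioi fun u hu => ?_
  have hu : 0 < u := hu
  simp only [smul_eq_mul]
  rw [← Real.rpow_mul hu.le, abs_two, Real.rpow_two]
  have : u ^ ((2 : ℝ) - 1) * u ^ ((2 : ℝ) * (1 / 2 - 1)) = 1 := by
    rw [← Real.rpow_add hu]
    norm_num
  linear_combination (-2 * Φ (u ^ 2)) * this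

lemma rpow_isBigO_mul_exp_neg_sqrt_log {a c : ℝ} (ha : a < 1) :
    (fun x : ℝ => x ^ a) =O[atTop] fun x : ℝ => x * Real.exp (-c * √(Real.log x)) := by
  refine IsBigO.of_bound 1 ?_
  have h : Tendsto (fun x => √(Real.log x)) atTop atTop :=
    Real.tendsto_sqrt_atTop.comp Real.tendsto_log_atTop
  filter_upwards [h.eventually_ge_atTop (c / (1 - a)), eventually_ge_atTop 1] with x hx hx1
  have hx0 : 0 < x := by linarith
  rw [div_le_iff₀ (by linarith)] at hx
  rw [one_mul, Real.norm_of_nonneg (by positivity), Real.norm_of_nonneg (by positivity)]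
  have h1 : √(Real.log x) * √(Real.log x) = Real.log x := Real.mul_self_sqrt (Real.log_nonneg hx1)
  calc x ^ a = x * Real.exp (-((1 - a) * Real.log x)) := by
        rw [Real.rpow_def_of_pos hx0]
        nth_rw 2 [← Real.exp_log hx0]
        rw [← Real.exp_add]
        ring_nf
    _ ≤ _ := by
        gcongr
        nlinarith [Real.sqrt_nonneg (Real.log x)]

lemma exists_tsum_idealLambda_sub_isBigO {Φ : ℝ → ℝ} (hΦ : ContDiff ℝ (⊤ : ℕ∞) Φ)
    (hΦc : HasCompactSupport Φ) :
    ∃ c > (0 : ℝ), (fun x : ℝ => ∑' n : ℕ,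
      idealLambda (Ideal.span {(n : GaussianInt)}) * Φ ((n / x) ^ 2) -
        x / 2 * mellinR Φ (1 / 2)) =O[atTop] fun x : ℝ => x * Real.exp (-c * √(Real.log x)) := by
  set g : ℝ → ℝ := fun u => Φ (u ^ 2) with hg
  have hgs : ContDiff ℝ (⊤ : ℕ∞) g := hΦ.comp (contDiff_id.pow 2)
  have hgc : HasCompactSupport g := by
    obtain ⟨R, hR1, hR⟩ := exists_forall_gt_eq_zero hΦc
    refine .of_support_subset_isCompact (isCompact_Icc (a := -R) (b := R)) fun u hu => ?_
    have h : u ^ 2 ≤ R := not_lt.mp fun h => hu (hR _ h)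
    constructor <;> nlinarith
  have hgs' : ContDiff ℝ (⊤ : ℕ∞) (fun u => (g u : ℂ)) := ofRealCLM.contDiff.comp hgs
  have hgc' : HasCompactSupport (fun u => (g u : ℂ)) := hgc.comp_left ofReal_zero
  obtain ⟨c, hc, hO⟩ := exists_tsum_residueClass_sub_isBigO (q := 4) (a := 3)
    (by decide) hgs' hgc'
  set rc := ArithmeticFunction.vonMangoldt.residueClass (3 : ZMod 4)
  set Λ : ℕ → ℝ := fun n => idealLambda (Ideal.span {(n : GaussianInt)})
  refine ⟨c, hc, ?_⟩
  have hO' : (fun x : ℝ => ∑' n : ℕ, rc n * g (n / x) -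
      1 / 2 * ∫ u in Set.Ioi (1 : ℝ), g (u / x)) =O[atTop]
      fun x : ℝ => x * Real.exp (-c * √(Real.log x)) := by
    refine (hO.norm_left.congr_left fun x => ?_).of_norm_left
    have htot : Nat.totient 4 = 2 := by decide
    rw [← Complex.norm_real, integral_complex_ofReal, htot]
    push_cast [ofReal_tsum]
    rw [one_div]
  have hd := tsum_mul_apply_div_isBigO hgs.continuous hgc (d := fun n => Λ n - 2 * rc n)
    (fun n => ?_) (fun n hn => ?_)
  · have h1 := (hd.trans (rpow_isBigO_mul_exp_neg_sqrt_log (c := c) (by norm_num)))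
    have h2 := (integral_Ioi_one_comp_div_sub_isBigO hgs.continuous hgc).trans
      ((rpow_isBigO_mul_exp_neg_sqrt_log (a := 0) (c := c) (by norm_num)).congr_left (by simp))
    refine ((h1.add (hO'.const_mul_left 2)).add h2).congr' ?_ .rfl
    filter_upwards [eventually_gt_atTop 0] with x hx
    have h3 : ∑' n : ℕ, (Λ n - 2 * rc n) * g (n / x) =
        ∑' n : ℕ, Λ n * g (n / x) - 2 * ∑' n : ℕ, rc n * g (n / x) := by
      rw [← tsum_mul_left, ← (summable_mul_apply_div hgc Λ hx).tsum_sub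
        ((summable_mul_apply_div hgc rc hx).mul_left 2)]
      exact tsum_congr fun n => by ring
    rw [h3, integral_Ioi_comp_sq]
    ring
  · have h1 := idealLambda_span_natCast_nonneg n
    have h2 := idealLambda_span_natCast_le n
    have h3 := ArithmeticFunction.vonMangoldt.residueClass_nonneg (3 : ZMod 4) n
    have h4 := (ArithmeticFunction.vonMangoldt.residueClass_le (3 : ZMod 4) n).trans
      ArithmeticFunction.vonMangoldt_le_log
    rw [abs_le]
    constructor <;> linarith
  · by_contra! h
    exact hn (sub_eq_zero.mpr (idealLambda_span_natCast_eq h.1 h.2))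

/-- Lemma 2.2: `|∑_{θ_𝔞 = 0} Λ(𝔞) Φ(N(𝔞)/X)|² = (X/4) Φ̃(1/2)² + O(X e^{-c√(log X)})`. -/
theorem inert_sum_squared_asymptotic (Φ : ℝ → ℝ) (hΦ : ContDiff ℝ (⊤ : ℕ∞) Φ) (hΦc : HasCompactSupport Φ)
    (hΦsupp : Function.support Φ ⊆ Set.Ioi 0) :
    ∃ c > (0 : ℝ),
      (fun X : ℝ => inertSum Φ X ^ 2 - X / 4 * mellinR Φ (1 / 2) ^ 2)
        =O[atTop] (fun X : ℝ => X * Real.exp (-c * Real.sqrt (Real.log X))) := by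
  obtain ⟨c, hc, hO⟩ := exists_tsum_idealLambda_sub_isBigO hΦ hΦc
  set m := mellinR Φ (1 / 2)
  have hle : (fun x : ℝ => x * Real.exp (-c * √(Real.log x))) =O[atTop] fun x => x := by
    refine IsBigO.of_bound 1 (.of_forall fun x => ?_)
    rw [norm_mul, one_mul, Real.norm_of_nonneg (Real.exp_nonneg _)]
    refine mul_le_of_le_one_right (norm_nonneg _) (Real.exp_le_one_iff.mpr ?_)
    nlinarith [Real.sqrt_nonneg (Real.log x)]
  have hprod := (hO.mul ((hO.trans hle).add ((isBigO_refl (fun x : ℝ => x) atTop).const_mul_left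
    m))).comp_tendsto Real.tendsto_sqrt_atTop
  refine ⟨c / 2, by positivity, (hprod.congr' ?_ .rfl).trans (IsBigO.of_bound 1 ?_)⟩
  · filter_upwards [eventually_gt_atTop 0] with X hX
    have h : inertSum Φ X = ∑' n : ℕ,
        idealLambda (Ideal.span {(n : GaussianInt)}) * Φ ((n / √X) ^ 2) := by
      simp only [inertSum_eq_tsum, div_pow, Real.sq_sqrt hX.le]
    simp only [Function.comp_apply, ← h]
    linear_combination (-m ^ 2 / 4) * Real.sq_sqrt hX.le
  · filter_upwards [eventually_ge_atTop 1] with X hX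
    have hX0 : 0 ≤ X := by linarith
    simp only [Function.comp_apply]
    rw [one_mul, Real.norm_of_nonneg (by positivity), Real.norm_of_nonneg (by positivity),
      mul_right_comm, Real.mul_self_sqrt hX0, Real.log_sqrt hX0]
    refine mul_le_mul_of_nonneg_left (Real.exp_le_exp.mpr ?_) hX0
    have h1 : √(Real.log X) / 2 ≤ √(Real.log X / 2) := by
      have := Real.log_nonneg hX
      apply Real.le_sqrt_of_sq_le
      rw [div_pow, Real.sq_sqrt this]
      linarith
    nlinarith
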